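/- arXiv:1810.01645 — 3 statements merged into one kernel-verified Lean document; each statement's English description precedes it below -/
import Mathlib

section
/- Suppose the covariate density g is bounded, bounded away from zero on [0,1], and uniformly continuous on [0,1]; the kernel w is a symmetric density with compact support [−1,1] and bounded derivative; the error density f has mean zero and finite absolute moment of order β > 2; and c_n → 0 with c_n^{−1} n^{2/β} = O(n/log n). Then for each m = 0,…,2d, sup_{0≤x≤1} | (1/n) Σ_{j=1}^n w_{nm}(Z_j − x) ε_j | = O_p((n c_n / log n)^{−1/2}), where w_{nm}(u) = (u^m / c_n^{m+1}) w(u/c_n). -/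
open MeasureTheory ProbabilityTheory Filter

/-- The re-scaled kernel `w_{nm}(u) = (u^m / c^{m+1}) w(u/c)`. -/
noncomputable def wnm (w : ℝ → ℝ) (c : ℝ) (m : ℕ) (u : ℝ) : ℝ :=
  u ^ m / c ^ (m + 1) * w (u / c)

lemma wnm_eq_inv_mul (w : ℝ → ℝ) {c : ℝ} (hc : 0 < c) (m : ℕ) (u : ℝ) :
    wnm w c m u = c⁻¹ * ((u / c) ^ m * w (u / c)) := by
  unfold wnm
  rw [div_pow, pow_succ]
  field_simp

/-- Truncation of a real number to zero outside `[-T, T]`. -/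
noncomputable def clip (T y : ℝ) : ℝ := if |y| ≤ T then y else 0

lemma measurable_clip (T : ℝ) : Measurable (clip T) :=
  Measurable.ite (measurableSet_le measurable_id.abs measurable_const) measurable_id
    measurable_const

lemma clip_of_abs_le {T y : ℝ} (h : |y| ≤ T) : clip T y = y := if_pos h

lemma abs_clip_le {T : ℝ} (hT : 0 ≤ T) (y : ℝ) : |clip T y| ≤ T := by
  unfold clip
  split_ifs with h
  · exact h
  · simpa using hT

lemma clip_sq_le {β : ℝ} (hβ : 2 ≤ β) (T y : ℝ) : clip T y ^ 2 ≤ 1 + |y| ^ β := by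
  have h0 : 0 ≤ |y| ^ β := Real.rpow_nonneg (abs_nonneg y) β
  unfold clip
  split_ifs
  · rcases le_total |y| 1 with h | h
    · have : y ^ 2 ≤ 1 := (sq_le_one_iff_abs_le_one y).2 h
      linarith
    · have : |y| ^ (2 : ℝ) ≤ |y| ^ β := Real.rpow_le_rpow_of_exponent_le h hβ
      rw [Real.rpow_two, sq_abs] at this
      linarith
  · nlinarith

lemma abs_sub_clip_le {β T : ℝ} (hβ : 1 ≤ β) (hT : 0 < T) (y : ℝ) :
    |y - clip T y| ≤ T ^ (1 - β) * |y| ^ β := by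
  unfold clip
  split_ifs with h
  · rw [sub_self, abs_zero]
    positivity
  · push Not at h
    have hy : 0 < |y| := hT.trans h
    have h1 : |y| ^ (1 - β) ≤ T ^ (1 - β) :=
      Real.rpow_le_rpow_of_nonpos hT h.le (by linarith)
    calc |y - 0| = |y| ^ (1 - β) * |y| ^ β := by
          rw [← Real.rpow_add hy]; simp
      _ ≤ _ := by gcongr

section Moments

variable {Ω : Type*} [MeasurableSpace Ω] {P : Measure Ω} [IsProbabilityMeasure P]

lemma integrable_of_abs_le {X : Ω → ℝ} (hX : Measurable X) {b : ℝ} (hb : ∀ ω, |X ω| ≤ b) :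
    Integrable X P :=
  Integrable.of_bound hX.aestronglyMeasurable b (ae_of_all _ hb)

lemma abs_integral_clip_le {e : Ω → ℝ} (hem : Measurable e) (he : Integrable e P)
    (he0 : ∫ ω, e ω ∂P = 0) {β T : ℝ} (hβ : 1 ≤ β) (hT : 0 < T)
    (hmom : Integrable (fun ω => |e ω| ^ β) P) :
    |∫ ω, clip T (e ω) ∂P| ≤ T ^ (1 - β) * ∫ ω, |e ω| ^ β ∂P := by
  have hi : Integrable (fun ω => clip T (e ω)) P :=
    integrable_of_abs_le ((measurable_clip T).comp hem) (fun ω => abs_clip_le hT.le _)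
  have h1 : ∫ ω, clip T (e ω) ∂P = -∫ ω, (e ω - clip T (e ω)) ∂P := by
    rw [integral_sub he hi, he0]; ring
  rw [h1, abs_neg, ← integral_const_mul]
  refine abs_integral_le_integral_abs.trans ?_
  exact integral_mono (he.sub hi).abs (hmom.const_mul _) (fun ω => abs_sub_clip_le hβ hT _)

lemma integral_clip_sq_le {e : Ω → ℝ} (hem : Measurable e) {β T : ℝ} (hβ : 2 ≤ β) (hT : 0 ≤ T)
    (hmom : Integrable (fun ω => |e ω| ^ β) P) :
    ∫ ω, clip T (e ω) ^ 2 ∂P ≤ 1 + ∫ ω, |e ω| ^ β ∂P := by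
  have hi : Integrable (fun ω => clip T (e ω) ^ 2) P := by
    refine integrable_of_abs_le (b := T ^ 2) (((measurable_clip T).comp hem).pow_const 2)
      (fun ω => ?_)
    rw [abs_pow]
    exact pow_le_pow_left₀ (abs_nonneg _) (abs_clip_le hT _) 2
  calc ∫ ω, clip T (e ω) ^ 2 ∂P ≤ ∫ ω, (1 + |e ω| ^ β) ∂P :=
        integral_mono hi ((integrable_const 1).add hmom) (fun ω => clip_sq_le hβ T _)
    _ = _ := by rw [integral_add (integrable_const 1) hmom]; simp

lemma measureReal_abs_gt_le {e : Ω → ℝ} {β T : ℝ} (hβ : 0 < β) (hT : 0 < T)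
    (hmom : Integrable (fun ω => |e ω| ^ β) P) :
    P.real {ω | T < |e ω|} ≤ (∫ ω, |e ω| ^ β ∂P) / T ^ β := by
  have hTβ : 0 < T ^ β := Real.rpow_pos_of_pos hT β
  rw [le_div_iff₀ hTβ, mul_comm]
  refine le_trans ?_ (mul_meas_ge_le_integral_of_nonneg
    (ae_of_all _ fun ω => Real.rpow_nonneg (abs_nonneg (e ω)) β) hmom (T ^ β))
  refine mul_le_mul_of_nonneg_left (measureReal_mono fun ω (hω : T < |e ω|) => ?_) hTβ.le
  exact Real.rpow_le_rpow hT.le hω.le hβ.le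

/-- The expectation of a function of `X` localised at a ball of radius `c` is `O(c)` when `X` has
a density bounded by `G`. -/
lemma integral_le_of_bounded_density {X : Ω → ℝ} (hX : Measurable X) {g : ℝ → ℝ} {G : ℝ}
    (hG : 0 ≤ G) (hg : ∀ x, g x ≤ G)
    (hdens : P.map X = volume.withDensity fun x => ENNReal.ofReal (g x))
    {h : ℝ → ℝ} {B c x : ℝ} (hB : 0 ≤ B) (hc : 0 ≤ c) (hh : Measurable h)
    (h0 : ∀ z, 0 ≤ h z) (hle : ∀ z, h z ≤ B) (hsupp : ∀ z, c < |z - x| → h z = 0) :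
    ∫ ω, h (X ω) ∂P ≤ B * (2 * c * G) := by
  set s : Set ℝ := Set.Icc (x - c) (x + c)
  have hmeas : P.real (X ⁻¹' s) ≤ 2 * c * G := by
    rw [measureReal_def]
    refine ENNReal.toReal_le_of_le_ofReal (by positivity) ?_
    rw [← Measure.map_apply hX measurableSet_Icc, hdens, withDensity_apply _ measurableSet_Icc]
    calc ∫⁻ a in s, ENNReal.ofReal (g a) ≤ ∫⁻ _ in s, ENNReal.ofReal G :=
          lintegral_mono fun a => ENNReal.ofReal_le_ofReal (hg a)
      _ = ENNReal.ofReal (2 * c * G) := by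
          rw [lintegral_const, Measure.restrict_apply_univ, Real.volume_Icc,
            ← ENNReal.ofReal_mul hG]
          congr 1; ring
  have hs : MeasurableSet (X ⁻¹' s) := hX measurableSet_Icc
  calc ∫ ω, h (X ω) ∂P ≤ ∫ ω, (X ⁻¹' s).indicator (fun _ => B) ω ∂P := by
        refine integral_mono
          (integrable_of_abs_le (b := B) (hh.comp hX) fun ω => ?_)
          ((integrable_const B).indicator hs) fun ω => ?_
        · rw [abs_of_nonneg (h0 _)]; exact hle _
        · by_cases hω : ω ∈ X ⁻¹' s
          · simpa [Set.indicator_of_mem hω] using hle (X ω)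
          · have : c < |X ω - x| := by
              by_contra hcon
              push Not at hcon
              rw [abs_le] at hcon
              exact hω ⟨by linarith, by linarith⟩
            simp [Set.indicator_of_notMem hω, hsupp _ this]
    _ = P.real (X ⁻¹' s) * B := by
        rw [integral_indicator hs, setIntegral_const, smul_eq_mul]
    _ ≤ B * (2 * c * G) := by
        rw [mul_comm]; gcongr

/-- Bernstein-type bound for the moment generating function of a product of bounded independent
variables. -/
lemma mgf_mul_le_exp {X Y : Ω → ℝ} (hX : Measurable X) (hY : Measurable Y) (hXY : IndepFun X Y P)
    {B T l p q b s : ℝ} (hXB : ∀ ω, |X ω| ≤ B) (hYT : ∀ ω, |Y ω| ≤ T)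
    (hl : |l| * (B * T) ≤ 1) (hp0 : 0 ≤ p) (hp : ∫ ω, |X ω| ∂P ≤ p) (hq0 : 0 ≤ q)
    (hq : ∫ ω, X ω ^ 2 ∂P ≤ q) (hb : |∫ ω, Y ω ∂P| ≤ b) (hs : ∫ ω, Y ω ^ 2 ∂P ≤ s) :
    mgf (fun ω => X ω * Y ω) P l ≤ Real.exp (|l| * (p * b) + l ^ 2 * (q * s)) := by
  have habs : ∀ ω, |X ω * Y ω| ≤ B * T := fun ω => by
    rw [abs_mul]
    exact mul_le_mul (hXB ω) (hYT ω) (abs_nonneg _) ((abs_nonneg _).trans (hXB ω))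
  have hlabs : ∀ ω, |l * (X ω * Y ω)| ≤ 1 := fun ω => by
    rw [abs_mul]
    exact (mul_le_mul_of_nonneg_left (habs ω) (abs_nonneg l)).trans hl
  have hm : Measurable fun ω => X ω * Y ω := hX.mul hY
  have hi1 : Integrable (fun ω => X ω * Y ω) P := integrable_of_abs_le hm habs
  have hi2 : Integrable (fun ω => X ω ^ 2 * Y ω ^ 2) P := by
    refine integrable_of_abs_le (b := (B * T) ^ 2) ((hX.pow_const 2).mul (hY.pow_const 2))
      fun ω => ?_
    rw [← mul_pow, abs_pow]
    exact pow_le_pow_left₀ (abs_nonneg _) (habs ω) 2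
  have hie : Integrable (fun ω => Real.exp (l * (X ω * Y ω))) P := by
    refine integrable_of_abs_le (b := Real.exp 1) (hm.const_mul l).exp fun ω => ?_
    rw [abs_of_pos (Real.exp_pos _)]
    exact Real.exp_le_exp.2 ((le_abs_self _).trans (hlabs ω))
  have hE1 : ∫ ω, X ω * Y ω ∂P = (∫ ω, X ω ∂P) * ∫ ω, Y ω ∂P :=
    hXY.integral_fun_mul_eq_mul_integral hX.aestronglyMeasurable hY.aestronglyMeasurable
  have hE2 : ∫ ω, X ω ^ 2 * Y ω ^ 2 ∂P = (∫ ω, X ω ^ 2 ∂P) * ∫ ω, Y ω ^ 2 ∂P :=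
    (hXY.comp (measurable_id.pow_const 2) (measurable_id.pow_const 2)
      : IndepFun (fun ω => X ω ^ 2) (fun ω => Y ω ^ 2) P).integral_fun_mul_eq_mul_integral
      (hX.pow_const 2).aestronglyMeasurable (hY.pow_const 2).aestronglyMeasurable
  have hb1 : l * ∫ ω, X ω * Y ω ∂P ≤ |l| * (p * b) := by
    refine (le_abs_self _).trans ?_
    rw [hE1, abs_mul, abs_mul]
    gcongr
    exact abs_integral_le_integral_abs.trans hp
  have hb2 : ∫ ω, X ω ^ 2 * Y ω ^ 2 ∂P ≤ q * s := by
    rw [hE2]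
    exact mul_le_mul hq hs (integral_nonneg fun ω => sq_nonneg _) hq0
  calc mgf (fun ω => X ω * Y ω) P l
      ≤ ∫ ω, (1 + l * (X ω * Y ω) + l ^ 2 * (X ω ^ 2 * Y ω ^ 2)) ∂P := by
        refine integral_mono hie
          (((integrable_const 1).add (hi1.const_mul l)).add (hi2.const_mul (l ^ 2))) fun ω => ?_
        have := (abs_le.1 (Real.abs_exp_sub_one_sub_id_le (hlabs ω))).2
        change Real.exp (l * (X ω * Y ω)) ≤ _
        nlinarith
    _ = 1 + l * (∫ ω, X ω * Y ω ∂P) + l ^ 2 * ∫ ω, X ω ^ 2 * Y ω ^ 2 ∂P := by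
        rw [integral_add (f := fun ω => 1 + l * (X ω * Y ω))
            ((integrable_const 1).add (hi1.const_mul l)) (hi2.const_mul (l ^ 2)),
          integral_add (integrable_const 1) (hi1.const_mul l), integral_const_mul,
          integral_const_mul]
        simp
    _ ≤ |l| * (p * b) + l ^ 2 * (q * s) + 1 := by
        have := mul_le_mul_of_nonneg_left hb2 (sq_nonneg l)
        linarith
    _ ≤ _ := Real.add_one_le_exp _

/-- Two-sided Chernoff bound for a sum of bounded independent variables. -/
lemma measureReal_abs_sum_ge_le {Y : ℕ → Ω → ℝ} (hY : ∀ j, Measurable (Y j))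
    (hind : iIndepFun Y P) {b l κ t : ℝ} (hb : ∀ j ω, |Y j ω| ≤ b) (hl : 0 ≤ l)
    (hpos : ∀ j, mgf (Y j) P l ≤ Real.exp κ) (hneg : ∀ j, mgf (Y j) P (-l) ≤ Real.exp κ) (n : ℕ) :
    P.real {ω | t ≤ |∑ j ∈ Finset.range n, Y j ω|} ≤ 2 * Real.exp (-l * t + n * κ) := by
  set S : Ω → ℝ := ∑ j ∈ Finset.range n, Y j
  have hSapp : ∀ ω, S ω = ∑ j ∈ Finset.range n, Y j ω := fun ω => Finset.sum_apply _ _ _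
  have hSm : Measurable S := by fun_prop
  have hSb : ∀ ω, |S ω| ≤ n * b := fun ω => by
    rw [hSapp]
    refine (Finset.abs_sum_le_sum_abs _ _).trans ?_
    refine (Finset.sum_le_sum fun j _ => hb j ω).trans ?_
    simp
  have hint : ∀ u : ℝ, Integrable (fun ω => Real.exp (u * S ω)) P := fun u => by
    refine integrable_of_abs_le (b := Real.exp (|u| * (n * b))) (hSm.const_mul u).exp fun ω => ?_
    rw [abs_of_pos (Real.exp_pos _)]
    refine Real.exp_le_exp.2 ((le_abs_self _).trans ?_)
    rw [abs_mul]
    exact mul_le_mul_of_nonneg_left (hSb ω) (abs_nonneg u)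
  have hmgf : ∀ u : ℝ, (∀ j, mgf (Y j) P u ≤ Real.exp κ) → mgf S P u ≤ Real.exp (n * κ) := by
    intro u hu
    rw [hind.mgf_sum hY]
    refine (Finset.prod_le_prod (fun j _ => mgf_nonneg) fun j _ => hu j).trans ?_
    rw [Finset.prod_const, Finset.card_range, ← Real.exp_nat_mul]
  have h1 : P.real {ω | t ≤ S ω} ≤ Real.exp (-l * t + n * κ) := by
    refine (measure_ge_le_exp_mul_mgf t hl (hint l)).trans ?_
    rw [Real.exp_add]
    gcongr
    exact hmgf l hpos
  have h2 : P.real {ω | S ω ≤ -t} ≤ Real.exp (-l * t + n * κ) := by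
    refine (measure_le_le_exp_mul_mgf (-t) (neg_nonpos.2 hl) (hint (-l))).trans ?_
    rw [Real.exp_add, show - -l * -t = -l * t by ring]
    gcongr
    exact hmgf (-l) hneg
  calc P.real {ω | t ≤ |∑ j ∈ Finset.range n, Y j ω|}
      ≤ P.real ({ω | t ≤ S ω} ∪ {ω | S ω ≤ -t}) := by
        refine measureReal_mono fun ω hω => ?_
        rw [Set.mem_ofPred_eq, ← hSapp, le_abs] at hω
        rcases hω with h | h
        · exact Or.inl h
        · exact Or.inr (show S ω ≤ -t by linarith)
    _ ≤ _ := by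
        have := measureReal_union_le (μ := P) {ω | t ≤ S ω} {ω | S ω ≤ -t}
        linarith

end Moments

section Kernel

variable {w : ℝ → ℝ}

lemma exists_pow_mul_kernel_bounds (hwsupp : Function.support w ⊆ Set.Icc (-1) 1)
    (hwdiff : Differentiable ℝ w) (hwderiv : ∃ M, ∀ x, |deriv w x| ≤ M) (m : ℕ) :
    ∃ B L : ℝ, 0 < B ∧ 0 ≤ L ∧ (∀ u, |u ^ m * w u| ≤ B) ∧
      (∀ u v, |u ^ m * w u - v ^ m * w v| ≤ L * |u - v|) ∧
      ∀ u, 1 < |u| → u ^ m * w u = 0 := by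
  obtain ⟨M, hM⟩ := hwderiv
  have hM0 : 0 ≤ M := (abs_nonneg _).trans (hM 0)
  have hzero : ∀ u, 1 < |u| → w u = 0 := fun u hu => by
    by_contra hne
    exact absurd (abs_le.2 (hwsupp hne)) (not_le.2 hu)
  have hderiv0 : ∀ u, 1 < |u| → deriv w u = 0 := fun u hu => by
    have hev : w =ᶠ[nhds u] fun _ => 0 := by
      filter_upwards [(isOpen_lt continuous_const continuous_abs).mem_nhds hu] with v hv
      exact hzero v hv
    rw [hev.deriv_eq, deriv_const]
  have hlip : ∀ u v, |w u - w v| ≤ M * |u - v| := fun u v =>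
    Convex.norm_image_sub_le_of_norm_deriv_le (s := Set.univ) (fun x _ => hwdiff x)
      (fun x _ => hM x) convex_univ (Set.mem_univ v) (Set.mem_univ u)
  have hwb : ∀ u, |u| ≤ 1 → |w u| ≤ M * 3 := fun u hu => by
    have h := hlip u 2
    rw [hzero 2 (by norm_num), sub_zero] at h
    refine h.trans (mul_le_mul_of_nonneg_left ?_ hM0)
    rw [abs_le] at hu ⊢
    constructor <;> linarith [hu.1, hu.2]
  have hpow : ∀ (k : ℕ) (u : ℝ), |u| ≤ 1 → |u ^ k| ≤ 1 := fun k u hu => by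
    rw [abs_pow]
    exact pow_le_one₀ (abs_nonneg u) hu
  have hd : ∀ u, HasDerivAt (fun u => u ^ m * w u)
      ((m : ℝ) * u ^ (m - 1) * w u + u ^ m * deriv w u) u := fun u =>
    (hasDerivAt_pow m u).mul (hwdiff u).hasDerivAt
  refine ⟨M * 3 + 1, m * (M * 3) + M, by positivity, by positivity, fun u => ?_, fun u v => ?_,
    fun u hu => by rw [hzero u hu, mul_zero]⟩
  · rcases le_or_gt |u| 1 with hu | hu
    · rw [abs_mul]
      nlinarith [hpow m u hu, hwb u hu, abs_nonneg (u ^ m), abs_nonneg (w u)]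
    · rw [hzero u hu, mul_zero, abs_zero]
      positivity
  · refine Convex.norm_image_sub_le_of_norm_deriv_le (f := fun u => u ^ m * w u) (s := Set.univ)
      (fun x _ => (hd x).differentiableAt) (fun x _ => ?_) convex_univ (Set.mem_univ v)
      (Set.mem_univ u)
    rw [(hd x).deriv, Real.norm_eq_abs]
    rcases le_or_gt |x| 1 with hx | hx
    · refine (abs_add_le _ _).trans (add_le_add ?_ ?_)
      · rw [mul_assoc, abs_mul, Nat.abs_cast, abs_mul]
        refine mul_le_mul_of_nonneg_left ?_ m.cast_nonneg
        nlinarith [hpow (m - 1) x hx, hwb x hx, abs_nonneg (x ^ (m - 1)), abs_nonneg (w x)]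
      · rw [abs_mul]
        nlinarith [hpow m x hx, hM x, abs_nonneg (x ^ m), abs_nonneg (deriv w x)]
    · rw [hzero x hx, hderiv0 x hx]
      simp only [mul_zero, add_zero, abs_zero]
      positivity

end Kernel

/-- Every point of `[0, 1]` is within `1 / N` of a point of the grid `i / N`, `i ≤ N`. -/
lemma exists_grid_point_near {N : ℕ} (hN : 0 < N) {x : ℝ} (hx : x ∈ Set.Icc (0 : ℝ) 1) :
    ∃ i ∈ Finset.range (N + 1), |x - (i : ℝ) / N| ≤ 1 / N := by
  have hN' : (0 : ℝ) < N := by exact_mod_cast hN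
  have hxN : 0 ≤ x * N := mul_nonneg hx.1 hN'.le
  refine ⟨⌊x * N⌋₊, ?_, ?_⟩
  · rw [Finset.mem_range, Nat.lt_succ_iff]
    refine Nat.floor_le_of_le ?_
    nlinarith [hx.2]
  · have h1 := Nat.floor_le hxN
    have h2 := Nat.lt_floor_add_one (x * N)
    rw [show x - (⌊x * N⌋₊ : ℝ) / N = (x * N - ⌊x * N⌋₊) / N by field_simp, abs_div,
      abs_of_pos hN']
    gcongr
    rw [abs_le]
    constructor <;> linarith

/-- A weighted sum with Lipschitz weights is controlled on `[0, 1]` by its values on a grid. -/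
lemma abs_weighted_sum_le_of_grid {V : ℝ → ℝ} {L c T t : ℝ} {n N : ℕ} (hN : 0 < N) (hc : 0 < c)
    (hL : 0 ≤ L) (hV : ∀ u v, |V u - V v| ≤ L * |u - v|) {z e : ℕ → ℝ}
    (he : ∀ j ∈ Finset.range n, |e j| ≤ T)
    (ht : ∀ i ∈ Finset.range (N + 1),
      |∑ j ∈ Finset.range n, V ((z j - (i : ℝ) / N) / c) * e j| ≤ t)
    {x : ℝ} (hx : x ∈ Set.Icc (0 : ℝ) 1) :
    |∑ j ∈ Finset.range n, V ((z j - x) / c) * e j| ≤ t + n * (L / (c * N) * T) := by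
  obtain ⟨i, hi, hxi⟩ := exists_grid_point_near hN hx
  have hdiff : |∑ j ∈ Finset.range n, V ((z j - x) / c) * e j
      - ∑ j ∈ Finset.range n, V ((z j - (i : ℝ) / N) / c) * e j| ≤ n * (L / (c * N) * T) := by
    rw [← Finset.sum_sub_distrib]
    refine (Finset.abs_sum_le_sum_abs _ _).trans ?_
    refine (Finset.sum_le_sum (g := fun _ => L / (c * N) * T) fun j hj => ?_).trans (by simp)
    rw [← sub_mul, abs_mul]
    refine mul_le_mul ?_ (he j hj) (abs_nonneg _) (by positivity)
    refine (hV _ _).trans ?_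
    rw [show (z j - x) / c - (z j - (i : ℝ) / N) / c = -((x - (i : ℝ) / N) / c) by ring, abs_neg,
      abs_div, abs_of_pos hc]
    calc L * (|x - (i : ℝ) / N| / c) ≤ L * (1 / N / c) := by gcongr
      _ = L / (c * N) := by rw [div_div, mul_one_div, mul_comm c]
  have := ht i hi
  rw [abs_le] at this hdiff ⊢
  constructor <;> linarith [this.1, this.2, hdiff.1, hdiff.2]

section Tail

variable {Ω : Type*} [MeasurableSpace Ω] {P : Measure Ω} [IsProbabilityMeasure P]

/-- Pointwise exponential tail bound for the truncated kernel-weighted error sum. -/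
lemma measureReal_abs_clipped_sum_ge_le {Z ε : ℕ → Ω → ℝ} (hZ : ∀ j, Measurable (Z j))
    (hε : ∀ j, Measurable (ε j)) (hiid : iIndepFun (fun j ω => (Z j ω, ε j ω)) P)
    (hZε : ∀ j, IndepFun (Z j) (ε j) P) {g : ℝ → ℝ} {G : ℝ} (hG : 0 ≤ G) (hg : ∀ x, g x ≤ G)
    (hdens : ∀ j, P.map (Z j) = volume.withDensity fun x => ENNReal.ofReal (g x))
    {V : ℝ → ℝ} {B : ℝ} (hVm : Measurable V) (hB : 0 < B) (hVB : ∀ u, |V u| ≤ B)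
    (hVs : ∀ u, 1 < |u| → V u = 0) {c T l b s : ℝ} (hc : 0 < c) (hT : 0 ≤ T) (hl : 0 ≤ l)
    (hlBT : l * (B * T) ≤ 1) (hb : ∀ j, |∫ ω, clip T (ε j ω) ∂P| ≤ b)
    (hs : ∀ j, ∫ ω, clip T (ε j ω) ^ 2 ∂P ≤ s) (x t : ℝ) (n : ℕ) :
    P.real {ω | t ≤ |∑ j ∈ Finset.range n, V ((Z j ω - x) / c) * clip T (ε j ω)|} ≤
      2 * Real.exp (-l * t +
        n * (l * (B * (2 * c * G) * b) + l ^ 2 * (B ^ 2 * (2 * c * G) * s))) := by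
  have hm : Measurable fun z : ℝ => V ((z - x) / c) :=
    hVm.comp ((measurable_id.sub_const x).div_const c)
  have hsupp : ∀ z, c < |z - x| → V ((z - x) / c) = 0 := fun z hz => by
    refine hVs _ ?_
    rwa [abs_div, abs_of_pos hc, one_lt_div hc]
  have hsq : ∀ u, V u ^ 2 ≤ B ^ 2 := fun u => by
    rw [← sq_abs]
    exact pow_le_pow_left₀ (abs_nonneg _) (hVB u) 2
  have hmgf : ∀ j u, |u| = l → mgf (fun ω => V ((Z j ω - x) / c) * clip T (ε j ω)) P u ≤
      Real.exp (l * (B * (2 * c * G) * b) + l ^ 2 * (B ^ 2 * (2 * c * G) * s)) := by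
    intro j u hu
    have h1 : ∫ ω, |V ((Z j ω - x) / c)| ∂P ≤ B * (2 * c * G) :=
      integral_le_of_bounded_density (hZ j) hG hg (hdens j) (h := fun z => |V ((z - x) / c)|)
        hB.le hc.le hm.abs (fun z => abs_nonneg _) (fun z => hVB _)
        (fun z hz => by rw [hsupp z hz, abs_zero])
    have h2 : ∫ ω, V ((Z j ω - x) / c) ^ 2 ∂P ≤ B ^ 2 * (2 * c * G) :=
      integral_le_of_bounded_density (hZ j) hG hg (hdens j) (h := fun z => V ((z - x) / c) ^ 2)
        (sq_nonneg B) hc.le (hm.pow_const 2) (fun z => sq_nonneg _) (fun z => hsq _)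
        (fun z hz => by rw [hsupp z hz]; simp)
    have h3 := mgf_mul_le_exp (P := P) (l := u) (hm.comp (hZ j)) ((measurable_clip T).comp (hε j))
      ((hZε j).comp hm (measurable_clip T)) (fun ω => hVB _) (fun ω => abs_clip_le hT _)
      (by rwa [hu]) (by positivity) h1 (by positivity) h2 (hb j) (hs j)
    rwa [hu, ← sq_abs u, hu] at h3
  refine measureReal_abs_sum_ge_le (b := B * T)
    (Y := fun j ω => V ((Z j ω - x) / c) * clip T (ε j ω))
    (fun j => (hm.comp (hZ j)).mul ((measurable_clip T).comp (hε j)))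
    (hiid.comp (fun _ p => V ((p.1 - x) / c) * clip T p.2)
      (fun _ => (hm.comp measurable_fst).mul ((measurable_clip T).comp measurable_snd)))
    (fun j ω => ?_) hl (fun j => hmgf j l (abs_of_nonneg hl))
    (fun j => hmgf j (-l) (by rw [abs_neg, abs_of_nonneg hl])) n
  rw [abs_mul]
  exact mul_le_mul (hVB _) (abs_clip_le hT _) (abs_nonneg _) hB.le

/-- Uniform tail bound on `[0, 1]` obtained from tail bounds on a grid and on the errors. -/
lemma measureReal_exists_abs_sum_gt_le {Z ε : ℕ → Ω → ℝ} {V : ℝ → ℝ} {L c T t a q : ℝ} {n N : ℕ}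
    (hN : 0 < N) (hc : 0 < c) (hL : 0 ≤ L) (hV : ∀ u v, |V u - V v| ≤ L * |u - v|)
    (hε : ∀ j, P.real {ω | T < |ε j ω|} ≤ a)
    (hgrid : ∀ x, P.real {ω | t ≤ |∑ j ∈ Finset.range n,
      V ((Z j ω - x) / c) * clip T (ε j ω)|} ≤ q) :
    P.real {ω | ∃ x ∈ Set.Icc (0 : ℝ) 1, t + n * (L / (c * N) * T) <
      |∑ j ∈ Finset.range n, V ((Z j ω - x) / c) * ε j ω|} ≤ n * a + (N + 1) * q := by
  set E : ℕ → Set Ω := fun j => {ω | T < |ε j ω|}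
  set F : ℕ → Set Ω := fun i => {ω | t ≤ |∑ j ∈ Finset.range n,
      V ((Z j ω - (i : ℝ) / N) / c) * clip T (ε j ω)|}
  have hsub : {ω | ∃ x ∈ Set.Icc (0 : ℝ) 1, t + n * (L / (c * N) * T) <
      |∑ j ∈ Finset.range n, V ((Z j ω - x) / c) * ε j ω|} ⊆
      (⋃ j ∈ Finset.range n, E j) ∪ ⋃ i ∈ Finset.range (N + 1), F i := by
    rintro ω ⟨x, hx, hlt⟩
    by_contra hcon
    rw [Set.mem_union, not_or, Set.mem_iUnion₂, Set.mem_iUnion₂] at hcon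
    obtain ⟨h1, h2⟩ := hcon
    have hle : ∀ j ∈ Finset.range n, |ε j ω| ≤ T := fun j hj =>
      not_lt.1 fun h => h1 ⟨j, hj, h⟩
    refine absurd hlt (not_lt.2 (abs_weighted_sum_le_of_grid (z := fun j => Z j ω)
      (e := fun j => ε j ω) hN hc hL hV hle (fun i hi => ?_) hx))
    refine le_of_not_ge fun h => h2 ⟨i, hi, ?_⟩
    change t ≤ _
    rwa [Finset.sum_congr rfl fun j hj => by rw [clip_of_abs_le (hle j hj)]]
  calc _ ≤ P.real ((⋃ j ∈ Finset.range n, E j) ∪ ⋃ i ∈ Finset.range (N + 1), F i) :=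
        measureReal_mono hsub
    _ ≤ P.real (⋃ j ∈ Finset.range n, E j) + P.real (⋃ i ∈ Finset.range (N + 1), F i) :=
        measureReal_union_le _ _
    _ ≤ ∑ j ∈ Finset.range n, P.real (E j) + ∑ i ∈ Finset.range (N + 1), P.real (F i) :=
        add_le_add (measureReal_biUnion_finset_le _ _) (measureReal_biUnion_finset_le _ _)
    _ ≤ ∑ j ∈ Finset.range n, a + ∑ i ∈ Finset.range (N + 1), q :=
        add_le_add (Finset.sum_le_sum fun j _ => hε j) (Finset.sum_le_sum fun i _ => hgrid _)
    _ = n * a + (N + 1) * q := by simp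

end Tail

/-- Elementary relations between the bandwidth `c`, the rate `r = (n c / log n)^{-1/2}` and the
truncation level `K n^{1/β}`. -/
lemma rate_relations {β C K c x : ℝ} (hβ : 2 < β) (hC : 1 ≤ C) (hK : 1 ≤ K) (hc : 0 < c)
    (hc1 : c ≤ 1) (hx : 3 ≤ x) (hcO : c⁻¹ * x ^ (2 / β) ≤ C * x / Real.log x) {r T : ℝ}
    (hr : r = (x * c / Real.log x) ^ (-(1 : ℝ) / 2)) (hT : T = K * x ^ (1 / β)) :
    0 < r ∧ x * c * r ^ 2 = Real.log x ∧ T * r ≤ K * C ∧ T ^ (1 - β) ≤ r ∧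
      T ^ β = K ^ β * x ∧ T / (c * x ^ 2) ≤ K * C * C * (c * r) := by
  have hx0 : 0 < x := by linarith
  have hx1 : 1 ≤ x := by linarith
  have hlog : 1 ≤ Real.log x := by
    rw [Real.le_log_iff_exp_le hx0]
    exact Real.exp_one_lt_three.le.trans hx
  have hlog0 : 0 < Real.log x := by linarith
  have hβ0 : 0 < β := by linarith
  have hbase : 0 < x * c / Real.log x := by positivity
  have hr0 : 0 < r := hr ▸ Real.rpow_pos_of_pos hbase _
  have hr2 : r ^ 2 = Real.log x / (x * c) := by
    rw [hr, ← Real.rpow_natCast, ← Real.rpow_mul hbase.le,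
      show -(1 : ℝ) / 2 * (2 : ℕ) = -1 by norm_num, Real.rpow_neg_one, inv_div]
  have hxβ : 0 < x ^ (1 / β) := Real.rpow_pos_of_pos hx0 _
  have hxβ2 : (x ^ (1 / β)) ^ 2 = x ^ (2 / β) := by
    rw [← Real.rpow_natCast, ← Real.rpow_mul hx0.le]
    congr 1
    push_cast
    ring
  have hone : 1 ≤ x ^ (2 / β) := Real.one_le_rpow hx1 (by positivity)
  have hO : x ^ (2 / β) * Real.log x ≤ C * x * c := by
    rw [inv_mul_le_iff₀ hc, mul_div_assoc', le_div_iff₀ hlog0] at hcO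
    linarith
  have hTr : T * r ≤ K * C := by
    rw [hT, mul_assoc]
    refine mul_le_mul_of_nonneg_left ?_ (by linarith)
    refine (sq_le_sq₀ (by positivity) (by linarith)).1 ?_
    rw [mul_pow, hxβ2, hr2, mul_div_assoc', div_le_iff₀ (by positivity)]
    have hCC : C * (x * c) ≤ C ^ 2 * (x * c) := by gcongr; nlinarith
    linarith
  have hT0 : 0 < T := by rw [hT]; positivity
  refine ⟨hr0, ?_, hTr, ?_, ?_, ?_⟩
  · rw [hr2]; field_simp
  · have h1 : T ^ (1 - β) ≤ (x ^ (1 / β)) ^ (1 - β) :=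
      Real.rpow_le_rpow_of_nonpos hxβ (by rw [hT]; nlinarith) (by linarith)
    have h2 : (x ^ (1 / β)) ^ (1 - β) ≤ x ^ (-(1 : ℝ) / 2) := by
      rw [← Real.rpow_mul hx0.le]
      refine Real.rpow_le_rpow_of_exponent_le hx1 ?_
      rw [div_mul_eq_mul_div, div_le_iff₀ hβ0]
      linarith
    refine h1.trans (h2.trans ?_)
    rw [hr]
    refine Real.rpow_le_rpow_of_nonpos hbase ?_ (by norm_num)
    rw [div_le_iff₀ hlog0]
    nlinarith
  · rw [hT, Real.mul_rpow (by linarith) hxβ.le, ← Real.rpow_mul hx0.le,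
      one_div_mul_cancel hβ0.ne', Real.rpow_one]
  · have hCc : 1 ≤ C * x * c := by nlinarith
    rw [div_le_iff₀ (by positivity)]
    refine le_of_mul_le_mul_right ?_ hr0
    refine hTr.trans ?_
    have : K * C * C * (c * r) * (c * x ^ 2) * r = K * C * (C * x * c * (x * c * r ^ 2)) := by ring
    rw [this, hr2, mul_div_cancel₀ _ (by positivity)]
    have hKC : 0 ≤ K * C := by positivity
    refine le_mul_of_one_le_right hKC ?_
    nlinarith

lemma local_poly_scaled_sum (w : ℝ → ℝ) {c : ℝ} (hc : 0 < c) (m n : ℕ) (z e : ℕ → ℝ) (x : ℝ) :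
    |(n : ℝ)⁻¹ * ∑ j ∈ Finset.range n, wnm w c m (z j - x) * e j| =
      (n * c)⁻¹ * |∑ j ∈ Finset.range n, ((z j - x) / c) ^ m * w ((z j - x) / c) * e j| := by
  have : ∑ j ∈ Finset.range n, wnm w c m (z j - x) * e j =
      c⁻¹ * ∑ j ∈ Finset.range n, ((z j - x) / c) ^ m * w ((z j - x) / c) * e j := by
    rw [Finset.mul_sum]
    exact Finset.sum_congr rfl fun j _ => by rw [wnm_eq_inv_mul w hc, mul_assoc]
  rw [this, ← mul_assoc, abs_mul, ← mul_inv, abs_of_nonneg (by positivity)]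

/-- Lemma l2: under Assumptions G and W, if the error density `f` has
mean zero and a finite absolute moment of order `β > 2`, and `c_n → 0` with
`c_n⁻¹ n^{2/β} = O(n / log n)`, then for each `m = 0, …, 2d`,
`sup_{0≤x≤1} |(1/n) Σ_j w_{nm}(Z_j - x) ε_j| = O_p((n c_n / log n)^{-1/2})`. -/
theorem local_poly_error_sum_Op {Ω : Type*} [MeasurableSpace Ω] (P : Measure Ω)
    [IsProbabilityMeasure P]
    (Z ε : ℕ → Ω → ℝ) (hZmeas : ∀ i, Measurable (Z i)) (hεmeas : ∀ i, Measurable (ε i))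
    (hiid : iIndepFun (fun i ω => (Z i ω, ε i ω)) P)
    (hident : ∀ i, Measure.map (fun ω => (Z i ω, ε i ω)) P
      = Measure.map (fun ω => (Z 0 ω, ε 0 ω)) P)
    (hZε : ∀ i, IndepFun (Z i) (ε i) P)
    (g f : ℝ → ℝ)
    (hgdens : Measure.map (Z 0) P = volume.withDensity fun x => ENNReal.ofReal (g x))
    (hfdens : Measure.map (ε 0) P = volume.withDensity fun x => ENNReal.ofReal (f x))
    -- Assumption G
    (hg0 : ∀ x, 0 ≤ g x) (hgbdd : ∃ C, ∀ x, g x ≤ C)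
    (hglow : ∃ c₀ > (0 : ℝ), ∀ x ∈ Set.Icc (0 : ℝ) 1, c₀ ≤ g x)
    (hgUC : UniformContinuousOn g (Set.Icc 0 1))
    -- Assumption W
    (w : ℝ → ℝ) (hw0 : ∀ x, 0 ≤ w x) (hwInt : Integrable w) (hwdens : ∫ x, w x = 1)
    (hwsym : ∀ x, w (-x) = w x) (hwsupp : Function.support w ⊆ Set.Icc (-1) 1)
    (hwdiff : Differentiable ℝ w) (hwderiv : ∃ M, ∀ x, |deriv w x| ≤ M)
    -- error moments
    (hεint : Integrable (ε 0) P) (hεmean : ∫ ω, ε 0 ω ∂P = 0)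
    (β : ℝ) (hβ : 2 < β) (hεmom : Integrable (fun ω => |ε 0 ω| ^ β) P)
    -- order of the smoother and bandwidths
    (d : ℕ) (c : ℕ → ℝ) (hcpos : ∀ n, 0 < c n)
    (hc0 : Tendsto c atTop (nhds 0))
    (hcO : ∃ C : ℝ, ∀ n : ℕ, 2 ≤ n →
        (c n)⁻¹ * (n : ℝ) ^ (2 / β) ≤ C * n / Real.log n) :
    ∀ m : ℕ, m ≤ 2 * d →
      ∀ δ > (0 : ℝ), ∃ M : ℝ, Filter.limsup (fun n : ℕ =>
        P {ω | (⨆ x : Set.Icc (0 : ℝ) 1,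
            |(n : ℝ)⁻¹ * ∑ j ∈ Finset.range n, wnm w (c n) m (Z j ω - x) * ε j ω|)
          > M * ((n : ℝ) * c n / Real.log n) ^ (-(1 : ℝ) / 2)})
        atTop < ENNReal.ofReal δ := by
  intro m _ δ hδ
  obtain ⟨G₀, hG₀⟩ := hgbdd
  obtain ⟨C₀, hC₀⟩ := hcO
  obtain ⟨B, L, hB, hL, hVB, hVL, hVs⟩ := exists_pow_mul_kernel_bounds hwsupp hwdiff hwderiv m
  set V : ℝ → ℝ := fun u => u ^ m * w u
  have hVm : Measurable V := (measurable_id.pow_const m).mul hwdiff.continuous.measurable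
  set G : ℝ := max G₀ 0
  have hG : 0 ≤ G := le_max_right _ _
  have hgG : ∀ x, g x ≤ G := fun x => (hG₀ x).trans (le_max_left _ _)
  set C : ℝ := max C₀ 1
  have hC : 1 ≤ C := le_max_right _ _
  have hid : ∀ j, IdentDistrib (fun ω => (Z j ω, ε j ω)) (fun ω => (Z 0 ω, ε 0 ω)) P P := fun j =>
    ⟨((hZmeas j).prodMk (hεmeas j)).aemeasurable, ((hZmeas 0).prodMk (hεmeas 0)).aemeasurable,
      hident j⟩
  have hidZ : ∀ j, IdentDistrib (Z j) (Z 0) P P := fun j => (hid j).comp measurable_fst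
  have hidε : ∀ j, IdentDistrib (ε j) (ε 0) P P := fun j => (hid j).comp measurable_snd
  have hidmom : ∀ j, IdentDistrib (fun ω => |ε j ω| ^ β) (fun ω => |ε 0 ω| ^ β) P P := fun j =>
    (hidε j).comp (u := fun y => |y| ^ β) (by fun_prop)
  have hdens : ∀ j, P.map (Z j) = volume.withDensity fun x => ENNReal.ofReal (g x) := fun j =>
    (hidZ j).map_eq.trans hgdens
  set A : ℝ := ∫ ω, |ε 0 ω| ^ β ∂P
  have hA : 0 ≤ A := integral_nonneg fun ω => Real.rpow_nonneg (abs_nonneg _) β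
  have hmom : ∀ j, Integrable (fun ω => |ε j ω| ^ β) P := fun j =>
    (hidmom j).integrable_iff.2 hεmom
  have hmomA : ∀ j, ∫ ω, |ε j ω| ^ β ∂P = A := fun j => (hidmom j).integral_eq
  have hint : ∀ j, Integrable (ε j) P := fun j => (hidε j).integrable_iff.2 hεint
  have hmean : ∀ j, ∫ ω, ε j ω ∂P = 0 := fun j => (hidε j).integral_eq.trans hεmean
  -- the truncation constant makes all errors untruncated up to probability `δ / 4`
  obtain ⟨K, hK, hKA⟩ : ∃ K : ℝ, 1 ≤ K ∧ A / K ^ β ≤ δ / 4 := by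
    have h := (tendsto_rpow_atTop (show 0 < β by linarith)).const_div_atTop A
    obtain ⟨K, h1, h2⟩ :=
      ((h.eventually (eventually_le_nhds (show (0 : ℝ) < δ / 4 by positivity))).and
        (eventually_ge_atTop 1)).exists
    exact ⟨K, h2, h1⟩
  have hK0 : 0 < K := by linarith
  set a : ℝ := (B * (K * C))⁻¹
  have ha : 0 < a := by positivity
  set D : ℝ := a * (B * (2 * G) * A) + a ^ 2 * (B ^ 2 * (2 * G) * (1 + A))
  set M₁ : ℝ := (D + 3) / a
  have haM : a * M₁ = D + 3 := mul_div_cancel₀ _ ha.ne'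
  refine ⟨M₁ + L * (K * C * C), ?_⟩
  refine lt_of_le_of_lt (b := ENNReal.ofReal (δ / 2)) (limsup_le_of_le (by isBoundedDefault) ?_)
    ((ENNReal.ofReal_lt_ofReal_iff hδ).2 (by linarith))
  filter_upwards [eventually_ge_atTop 3, eventually_ge_atTop ⌈16 / δ⌉₊,
    hc0.eventually (eventually_le_nhds (show (0 : ℝ) < 1 by norm_num))] with n hn hnδ hcn
  have hn3 : (3 : ℝ) ≤ n := by exact_mod_cast hn
  have hn0 : (0 : ℝ) < n := by linarith
  have hnδ' : 16 / δ ≤ n := Nat.ceil_le.1 hnδ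
  have hcpn := hcpos n
  have hlog0 : 0 < Real.log n := Real.log_pos (by linarith)
  have hcn' : (c n)⁻¹ * (n : ℝ) ^ (2 / β) ≤ C * n / Real.log n :=
    (hC₀ n (by omega)).trans (by gcongr; exact le_max_left _ _)
  set r : ℝ := ((n : ℝ) * c n / Real.log n) ^ (-(1 : ℝ) / 2) with hr
  set T : ℝ := K * (n : ℝ) ^ (1 / β) with hT
  obtain ⟨hr0, hr2, hTr, hTβ1, hTβ, hTgrid⟩ :=
    rate_relations hβ hC hK hcpn hcn hn3 hcn' hr hT
  have hT0 : 0 < T := by positivity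
  have hlBT : a * r * (B * T) ≤ 1 := by
    calc a * r * (B * T) = a * (B * (T * r)) := by ring
      _ ≤ a * (B * (K * C)) := by gcongr
      _ = 1 := inv_mul_cancel₀ (by positivity)
  have hb : ∀ j, |∫ ω, clip T (ε j ω) ∂P| ≤ A * r := fun j => by
    have h := abs_integral_clip_le (hεmeas j) (hint j) (hmean j) (by linarith) hT0 (hmom j)
    rw [hmomA] at h
    nlinarith
  have hs : ∀ j, ∫ ω, clip T (ε j ω) ^ 2 ∂P ≤ 1 + A := fun j => by
    have h := integral_clip_sq_le (hεmeas j) hβ.le hT0.le (hmom j)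
    rwa [hmomA] at h
  have htail : ∀ x, P.real {ω | M₁ * (n * c n * r) ≤ |∑ j ∈ Finset.range n,
      V ((Z j ω - x) / c n) * clip T (ε j ω)|} ≤ 2 * ((n : ℝ) ^ 3)⁻¹ := fun x => by
    refine (measureReal_abs_clipped_sum_ge_le hZmeas hεmeas hiid hZε hG hgG hdens hVm hB hVB hVs
      hcpn hT0.le (l := a * r) (by positivity) hlBT hb hs x _ n).trans_eq ?_
    have hexp : -(a * r) * (M₁ * (n * c n * r)) + n * (a * r * (B * (2 * c n * G) * (A * r)) +
        (a * r) ^ 2 * (B ^ 2 * (2 * c n * G) * (1 + A))) = -(3 * Real.log n) := by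
      calc _ = (-(a * M₁) + D) * (n * c n * r ^ 2) := by simp only [D]; ring
        _ = _ := by rw [haM, hr2]; ring
    rw [hexp, Real.exp_neg, mul_comm 3, Real.exp_mul, Real.exp_log hn0]
    norm_num
  have herr : ∀ j, P.real {ω | T < |ε j ω|} ≤ A / T ^ β := fun j => by
    have h := measureReal_abs_gt_le (by linarith) hT0 (hmom j)
    rwa [hmomA] at h
  have hmain := measureReal_exists_abs_sum_gt_le (N := n ^ 2) (by positivity) hcpn hL hVL herr htail
  have hprob : n * (A / T ^ β) + (((n ^ 2 : ℕ) : ℝ) + 1) * (2 * ((n : ℝ) ^ 3)⁻¹) ≤ δ / 2 := by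
    have h1 : n * (A / T ^ β) = A / K ^ β := by
      rw [hTβ]
      field_simp
    have h2 : (((n ^ 2 : ℕ) : ℝ) + 1) * (2 * ((n : ℝ) ^ 3)⁻¹) ≤ 4 / n := by
      push_cast
      rw [← div_eq_mul_inv, mul_div_assoc', div_le_div_iff₀ (by positivity) hn0]
      nlinarith [mul_pos hn0 hn0, mul_pos hn0 (mul_pos hn0 hn0)]
    have h3 : 4 / (n : ℝ) ≤ δ / 4 := by
      rw [div_le_iff₀ hδ] at hnδ'
      rw [div_le_div_iff₀ hn0 (by norm_num)]
      linarith
    linarith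
  rw [← ENNReal.ofReal_toReal (measure_ne_top P _)]
  refine ENNReal.ofReal_le_ofReal (le_trans (measureReal_mono ?_) (hmain.trans hprob))
  intro ω hω
  by_contra hcon
  refine (Set.mem_ofPred_eq ▸ hω : _ < _).not_ge (ciSup_le fun x => ?_)
  have hx : |∑ j ∈ Finset.range n, V ((Z j ω - x) / c n) * ε j ω| ≤
      M₁ * (n * c n * r) + n * (L / (c n * (n ^ 2 : ℕ)) * T) :=
    not_lt.1 fun h => hcon ⟨x, x.2, h⟩
  rw [local_poly_scaled_sum w hcpn m n (fun j => Z j ω) (fun j => ε j ω),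
    inv_mul_le_iff₀ (by positivity)]
  refine hx.trans ?_
  have hgrid : n * (L / (c n * (n ^ 2 : ℕ)) * T) ≤ n * (L * (K * C * C * (c n * r))) := by
    push_cast
    rw [div_mul_eq_mul_div, mul_div_assoc]
    gcongr
  calc _ ≤ M₁ * (n * c n * r) + n * (L * (K * C * C * (c n * r))) := by gcongr
    _ = _ := by ring
end

section
/- Let ε_1, …, ε_n be i.i.d. with continuous distribution function F, let 𝔽 be their empirical distribution function, and let k be a probability density with compact support [−1,1]. For a ∈ ℝ set F_a(t) = ∫ F(t−ax) k(x) dx and 𝔽_a(t) = ∫ 𝔽(t−ax) k(x) dx. If a_n → 0, then G_n = n^{1/2} sup_{t∈ℝ} | 𝔽_{a_n}(t) − F_{a_n}(t) − 𝔽(t) + F(t) | = o_p(1). In particular, with W_n = n^{1/2}(𝔽 − F), G_n ≤ sup_{t∈ℝ} sup_{|s|≤|a_n|} |W_n(t+s) − W_n(t)|. -/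
open MeasureTheory ProbabilityTheory Filter

/-- The empirical distribution function `𝔽(t) = (1/n) Σ_{i=1}^n 1{ε_i ≤ t}`. -/
noncomputable def empDF {Ω : Type*} (ε : ℕ → Ω → ℝ) (n : ℕ) (ω : Ω) (t : ℝ) : ℝ :=
  (n : ℝ)⁻¹ * ∑ i ∈ Finset.range n, if ε i ω ≤ t then (1 : ℝ) else 0

/-- Telescoping along dyadic floors: a function on the dyadic rationals whose increments at level
`m` are at most `c (9/10)^m` stays close to its value at the coarser dyadic floor. -/
lemma abs_sub_dyadic_floor_le {S : ℝ → ℝ} {c : ℝ} {m₀ D : ℕ}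
    (h : ∀ m, m₀ ≤ m → m ≤ m₀ + D → ∀ j : ℕ, j < 2 ^ m →
      |S (((j + 1 : ℕ) : ℝ) / 2 ^ m) - S ((j : ℝ) / 2 ^ m)| ≤ c * (9 / 10) ^ m) (hc : 0 ≤ c)
    (d : ℕ) (hd : d ≤ D) (i : ℕ) (hi : i ≤ 2 ^ (m₀ + d)) :
    |S ((i : ℝ) / 2 ^ (m₀ + d)) - S (((i / 2 ^ d : ℕ) : ℝ) / 2 ^ m₀)|
      ≤ 9 * c * ((9 / 10) ^ m₀ - (9 / 10) ^ (m₀ + d)) := by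
  induction d generalizing i with
  | zero => simp
  | succ d ih =>
    have ih' := ih (by omega) (i / 2) (by rw [← add_assoc, pow_succ] at hi; omega)
    rw [Nat.div_div_eq_div_mul, ← pow_succ'] at ih'
    have step : |S ((i : ℝ) / 2 ^ (m₀ + (d + 1))) - S (((i / 2 : ℕ) : ℝ) / 2 ^ (m₀ + d))|
        ≤ c * (9 / 10) ^ (m₀ + (d + 1)) := by
      have e : (((i / 2 : ℕ) : ℝ) / 2 ^ (m₀ + d))
          = ((2 * (i / 2) : ℕ) : ℝ) / 2 ^ (m₀ + (d + 1)) := by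
        push_cast
        rw [← add_assoc, pow_succ]
        field_simp
      rw [e]
      rcases Nat.even_or_odd' i with ⟨r, hr | hr⟩
      · have : 2 * (i / 2) = i := by omega
        rw [this, sub_self, abs_zero]
        positivity
      · have h2 : 2 * (i / 2) = 2 * r := by omega
        rw [h2]
        subst hr
        exact h _ (by omega) (by omega) _ (by omega)
    refine (abs_sub_le _ _ _).trans ((add_le_add step ih').trans (le_of_eq ?_))
    rw [← add_assoc, pow_succ (9 / 10 : ℝ) (m₀ + d)]
    ring

/-- Chaining: dyadic increments bounded by `c (9/10)^m` at the levels `m₀, …, m₀ + D` control the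
oscillation of `S` over the finest grid at scale `2^{-m₀}`. -/
lemma abs_sub_le_of_dyadic_increments {S : ℝ → ℝ} {c : ℝ} {m₀ D : ℕ}
    (h : ∀ m, m₀ ≤ m → m ≤ m₀ + D → ∀ j : ℕ, j < 2 ^ m →
      |S (((j + 1 : ℕ) : ℝ) / 2 ^ m) - S ((j : ℝ) / 2 ^ m)| ≤ c * (9 / 10) ^ m) (hc : 0 ≤ c)
    {i i' : ℕ} (hii : i ≤ i') (hi' : i' ≤ 2 ^ (m₀ + D)) (hd : i' ≤ i + 2 ^ D) :
    |S ((i' : ℝ) / 2 ^ (m₀ + D)) - S ((i : ℝ) / 2 ^ (m₀ + D))| ≤ 19 * c * (9 / 10) ^ m₀ := by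
  have h1 := abs_sub_dyadic_floor_le h hc D le_rfl i (hii.trans hi')
  have h2 := abs_sub_dyadic_floor_le h hc D le_rfl i' hi'
  have hpos : (0 : ℝ) ≤ c * (9 / 10) ^ (m₀ + D) := by positivity
  have h3 : |S (((i' / 2 ^ D : ℕ) : ℝ) / 2 ^ m₀) - S (((i / 2 ^ D : ℕ) : ℝ) / 2 ^ m₀)|
      ≤ c * (9 / 10) ^ m₀ := by
    have hle : i / 2 ^ D ≤ i' / 2 ^ D := Nat.div_le_div_right hii
    have hle' : i' / 2 ^ D ≤ i / 2 ^ D + 1 := by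
      rw [← Nat.add_div_right _ (by positivity)]
      exact Nat.div_le_div_right hd
    rcases hle.eq_or_lt with he | hlt
    · rw [he, sub_self, abs_zero]
      positivity
    · have he : i' / 2 ^ D = i / 2 ^ D + 1 := by omega
      rw [he]
      refine h m₀ le_rfl (by omega) _ ?_
      have : i' / 2 ^ D ≤ 2 ^ m₀ := by
        rw [pow_add] at hi'
        exact Nat.div_le_of_le_mul (by rwa [mul_comm])
      omega
  rw [abs_le] at h1 h2 h3 ⊢
  constructor <;> linarith [h1.1, h1.2, h2.1, h2.2, h3.1, h3.2]

/-- The moment generating function of a Bernoulli variable. -/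
lemma mgf_indicator_comp {Ω : Type*} [MeasurableSpace Ω] {P : Measure Ω} [IsProbabilityMeasure P]
    {X : Ω → ℝ} (hX : Measurable X) {B : Set ℝ} (hB : MeasurableSet B) (θ : ℝ) :
    mgf (fun ω => B.indicator 1 (X ω)) P θ
      = 1 + (P.map X).real B * (Real.exp θ - 1) := by
  have e : (fun ω => Real.exp (θ * B.indicator 1 (X ω)))
      = fun ω => 1 + (X ⁻¹' B).indicator (fun _ => Real.exp θ - 1) ω := by
    funext ω
    by_cases h : X ω ∈ B <;> simp [h]
  rw [mgf, e, integral_add (integrable_const _)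
    ((integrable_const _).indicator (hX hB)), integral_indicator_const _ (hX hB),
    map_measureReal_apply hX hB]
  simp

/-- Exponential moment bound for a centred binomial count. -/
lemma exp_mul_mgf_count_le {Ω : Type*} [MeasurableSpace Ω] {P : Measure Ω}
    [IsProbabilityMeasure P] {ε : ℕ → Ω → ℝ} (hmeas : ∀ i, Measurable (ε i))
    (hindep : iIndepFun ε P) {μ : Measure ℝ} (hident : ∀ i, P.map (ε i) = μ)
    {B : Set ℝ} (hB : MeasurableSet B) (n : ℕ) {θ : ℝ} (hθ : |θ| ≤ 1) :
    Real.exp (-θ * (n * μ.real B))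
        * mgf (∑ i ∈ Finset.range n, fun ω => B.indicator 1 (ε i ω)) P θ
      ≤ Real.exp (n * μ.real B * θ ^ 2) := by
  have hg : Measurable (B.indicator (1 : ℝ → ℝ)) := measurable_one.indicator hB
  have hind : iIndepFun (fun i ω => B.indicator (1 : ℝ → ℝ) (ε i ω)) P :=
    hindep.comp (fun _ => B.indicator 1) (fun _ => hg)
  have hm : mgf (∑ i ∈ Finset.range n, fun ω => B.indicator 1 (ε i ω)) P θ
      = (1 + μ.real B * (Real.exp θ - 1)) ^ n := by
    rw [hind.mgf_sum (fun i => hg.comp (hmeas i))]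
    simp [mgf_indicator_comp (hmeas _) hB, hident]
  have hp : 0 ≤ μ.real B := measureReal_nonneg
  have hexp : Real.exp θ - 1 - θ ≤ θ ^ 2 :=
    (le_abs_self _).trans (Real.abs_exp_sub_one_sub_id_le hθ)
  have hp1 : μ.real B ≤ 1 := by
    rw [← hident 0]
    have := Measure.isProbabilityMeasure_map (μ := P) (hmeas 0).aemeasurable
    exact measureReal_le_one
  have hbase : 0 ≤ 1 + μ.real B * (Real.exp θ - 1) := by
    nlinarith [Real.exp_pos θ]
  have hle : 1 + μ.real B * (Real.exp θ - 1) ≤ Real.exp (μ.real B * (θ + θ ^ 2)) := by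
    have := Real.add_one_le_exp (μ.real B * (θ + θ ^ 2))
    nlinarith
  rw [hm]
  calc _ ≤ Real.exp (-θ * (n * μ.real B)) * Real.exp (μ.real B * (θ + θ ^ 2)) ^ n := by gcongr
    _ = _ := by
      rw [← Real.exp_nat_mul, ← Real.exp_add]
      ring_nf

/-- Two-sided exponential tail bound for a centred binomial count with mean at least one. -/
lemma measureReal_abs_count_sub_ge_le {Ω : Type*} [MeasurableSpace Ω] {P : Measure Ω}
    [IsProbabilityMeasure P] {ε : ℕ → Ω → ℝ} (hmeas : ∀ i, Measurable (ε i))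
    (hindep : iIndepFun ε P) {μ : Measure ℝ} (hident : ∀ i, P.map (ε i) = μ)
    {B : Set ℝ} (hB : MeasurableSet B) (n : ℕ) (hn : 1 ≤ n * μ.real B) (x : ℝ) :
    P.real {ω | x * Real.sqrt (n * μ.real B)
        ≤ |∑ i ∈ Finset.range n, B.indicator (1 : ℝ → ℝ) (ε i ω) - n * μ.real B|}
      ≤ 2 * Real.exp (1 - x) := by
  set q : ℝ := n * μ.real B with hq
  set r : ℝ := Real.sqrt q with hr
  have hr1 : 1 ≤ r := Real.one_le_sqrt.2 hn
  have hrq : r ^ 2 = q := Real.sq_sqrt (by linarith)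
  set T : Ω → ℝ := ∑ i ∈ Finset.range n, fun ω => B.indicator 1 (ε i ω) with hT
  have hTapp : ∀ ω, T ω = ∑ i ∈ Finset.range n, B.indicator (1 : ℝ → ℝ) (ε i ω) := by
    intro ω
    simp [hT]
  have hg : Measurable (B.indicator (1 : ℝ → ℝ)) := measurable_one.indicator hB
  have hTm : Measurable T := by
    rw [funext hTapp]
    exact Finset.measurable_sum _ (fun i _ => hg.comp (hmeas i))
  have hTb : ∀ ω, |T ω| ≤ n := by
    intro ω
    rw [hTapp]
    refine (Finset.abs_sum_le_sum_abs _ _).trans ?_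
    refine (Finset.sum_le_card_nsmul _ _ 1 fun i _ => ?_).trans (by simp)
    by_cases h : ε i ω ∈ B <;> simp [h]
  have hint : ∀ θ : ℝ, Integrable (fun ω => Real.exp (θ * T ω)) P := by
    intro θ
    refine Integrable.of_bound (hTm.const_mul θ).exp.aestronglyMeasurable
      (Real.exp (|θ| * n)) (ae_of_all _ fun ω => ?_)
    rw [Real.norm_eq_abs, Real.abs_exp, Real.exp_le_exp]
    refine (le_abs_self _).trans ?_
    rw [abs_mul]
    exact mul_le_mul_of_nonneg_left (hTb ω) (abs_nonneg _)
  have hθ : |r⁻¹| ≤ 1 := by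
    rw [abs_of_pos (by positivity)]
    exact inv_le_one_of_one_le₀ hr1
  have hqr : q * r⁻¹ ^ 2 = 1 := by
    rw [← hrq]
    field_simp
  have hup : P.real {ω | q + x * r ≤ T ω} ≤ Real.exp (1 - x) := by
    refine (measure_ge_le_exp_mul_mgf (q + x * r) (by positivity) (hint r⁻¹)).trans ?_
    have hb := exp_mul_mgf_count_le hmeas hindep hident hB n hθ
    rw [← hq, hqr] at hb
    have e : Real.exp (-r⁻¹ * (q + x * r)) = Real.exp (-x) * Real.exp (-r⁻¹ * q) := by
      rw [← Real.exp_add]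
      congr 1
      field_simp
      ring
    rw [e, mul_assoc, sub_eq_neg_add, Real.exp_add]
    gcongr
  have hlo : P.real {ω | T ω ≤ q - x * r} ≤ Real.exp (1 - x) := by
    refine (measure_le_le_exp_mul_mgf (q - x * r) (by simp; positivity) (hint (-r⁻¹))).trans ?_
    have hb := exp_mul_mgf_count_le hmeas hindep hident hB n (θ := -r⁻¹) (by rwa [abs_neg])
    rw [← hq, neg_sq, hqr] at hb
    have e : Real.exp (-(-r⁻¹) * (q - x * r)) = Real.exp (-x) * Real.exp (-(-r⁻¹) * q) := by
      rw [← Real.exp_add]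
      congr 1
      field_simp
      ring
    rw [e, mul_assoc, sub_eq_neg_add, Real.exp_add]
    gcongr
  have hsub : {ω | x * r ≤ |∑ i ∈ Finset.range n, B.indicator (1 : ℝ → ℝ) (ε i ω) - q|}
      ⊆ {ω | q + x * r ≤ T ω} ∪ {ω | T ω ≤ q - x * r} := by
    intro ω hω
    simp only [Set.mem_ofPred_eq, ← hTapp, le_abs] at hω
    rcases hω with h | h
    · left
      simp only [Set.mem_ofPred_eq]
      linarith
    · right
      simp only [Set.mem_ofPred_eq]
      linarith
  calc _ ≤ P.real ({ω | q + x * r ≤ T ω} ∪ {ω | T ω ≤ q - x * r}) := measureReal_mono hsub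
    _ ≤ _ := measureReal_union_le _ _
    _ ≤ _ := by linarith

/-- The sets on which the distribution function lies below level `u`, completed to be empty at
level `0` and everything at level `1`. -/
def cdfSublevel (μ : Measure ℝ) (u : ℝ) : Set ℝ := {x | cdf μ x < u ∨ 1 ≤ u}

lemma mem_cdfSublevel {μ : Measure ℝ} {u x : ℝ} :
    x ∈ cdfSublevel μ u ↔ cdf μ x < u ∨ 1 ≤ u := Iff.rfl

lemma cdfSublevel_mono (μ : Measure ℝ) : Monotone (cdfSublevel μ) := by
  intro u v huv x hx
  rw [mem_cdfSublevel] at hx ⊢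
  exact hx.imp (fun h => h.trans_le huv) (fun h => h.trans huv)

lemma measurableSet_cdfSublevel (μ : Measure ℝ) (u : ℝ) : MeasurableSet (cdfSublevel μ u) :=
  (measurableSet_lt (monotone_cdf μ).measurable measurable_const).union (MeasurableSet.const _)

lemma exists_cdf_eq {μ : Measure ℝ} (hcont : Continuous (cdf μ)) {u : ℝ} (h0 : 0 < u)
    (h1 : u < 1) : ∃ q, cdf μ q = u := by
  obtain ⟨b, hb⟩ := ((tendsto_cdf_atBot μ).eventually_le_const h0).exists
  obtain ⟨c, hc⟩ := ((tendsto_cdf_atTop μ).eventually_const_le h1).exists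
  exact mem_range_of_exists_le_of_exists_ge hcont ⟨b, hb⟩ ⟨c, hc⟩

/-- The probability integral transform. -/
lemma measureReal_cdfSublevel {μ : Measure ℝ} [IsProbabilityMeasure μ]
    (hcont : Continuous (cdf μ)) {u : ℝ} (h0 : 0 ≤ u) (h1 : u ≤ 1) :
    μ.real (cdfSublevel μ u) = u := by
  rcases h1.eq_or_lt with rfl | h1
  · have : cdfSublevel μ 1 = Set.univ := by
      ext x
      simp [mem_cdfSublevel]
    simp [this]
  rcases h0.eq_or_lt with rfl | h0
  · have : cdfSublevel μ 0 = ∅ := by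
      ext x
      simp [mem_cdfSublevel, cdf_nonneg]
    simp [this]
  apply le_antisymm
  · obtain ⟨q, hq⟩ := exists_cdf_eq hcont h0 h1
    have hsub : cdfSublevel μ u ⊆ Set.Iic q := by
      intro x hx
      rcases mem_cdfSublevel.1 hx with hx | hx
      · rw [← hq] at hx
        exact ((monotone_cdf μ).reflect_lt hx).le
      · linarith
    calc _ ≤ μ.real (Set.Iic q) := measureReal_mono hsub
      _ = u := by rw [← cdf_eq_real, hq]
  · refine le_of_forall_lt_imp_le_of_dense fun v hv => ?_
    rcases le_or_gt v 0 with hv0 | hv0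
    · exact hv0.trans measureReal_nonneg
    obtain ⟨q, hq⟩ := exists_cdf_eq hcont hv0 (hv.trans h1)
    rw [← hq, cdf_eq_real]
    refine measureReal_mono fun x hx => ?_
    exact Or.inl (((monotone_cdf μ) hx).trans_lt (hq ▸ hv))

lemma uniformContinuous_cdf {μ : Measure ℝ} (hcont : Continuous (cdf μ)) :
    UniformContinuous (cdf μ) := by
  rw [Metric.uniformContinuous_iff]
  intro e he
  obtain ⟨b, hb⟩ := ((tendsto_cdf_atBot μ).eventually_lt_const he).exists
  obtain ⟨c, hc⟩ := ((tendsto_cdf_atTop μ).eventually_const_lt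
    (show 1 - e < 1 by linarith)).exists
  have hu := (isCompact_Icc (a := b - 1) (b := c + 1)).uniformContinuousOn_of_continuous
    hcont.continuousOn
  rw [Metric.uniformContinuousOn_iff] at hu
  obtain ⟨δ, hδ, h⟩ := hu e he
  refine ⟨min δ 1, by positivity, fun {x y} hxy => ?_⟩
  have hd : |x - y| < δ := hxy.trans_le (min_le_left _ _)
  have hd1 : |x - y| < 1 := hxy.trans_le (min_le_right _ _)
  have hx0 := cdf_nonneg μ x
  have hy0 := cdf_nonneg μ y
  have hx1 := cdf_le_one μ x
  have hy1 := cdf_le_one μ y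
  rw [abs_lt] at hd1
  by_cases hl : x ≤ b ∧ y ≤ b
  · have hx := monotone_cdf μ hl.1
    have hy := monotone_cdf μ hl.2
    rw [Real.dist_eq, abs_lt]
    constructor <;> linarith
  by_cases hr : c ≤ x ∧ c ≤ y
  · have hx := monotone_cdf μ hr.1
    have hy := monotone_cdf μ hr.2
    rw [Real.dist_eq, abs_lt]
    constructor <;> linarith
  have hl' : b < x ∨ b < y := by
    by_contra! hcon
    exact hl hcon
  have hr' : x < c ∨ y < c := by
    by_contra! hcon
    exact hr hcon
  refine h x ⟨?_, ?_⟩ y ⟨?_, ?_⟩ hd <;> rcases hl' with h1 | h1 <;> rcases hr' with h2 | h2 <;>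
    linarith

/-- The centred count of observations in the sublevel set of the distribution function. -/
noncomputable def sublevelCount {Ω : Type*} (ε : ℕ → Ω → ℝ) (μ : Measure ℝ) (n : ℕ) (ω : Ω)
    (u : ℝ) : ℝ :=
  ∑ i ∈ Finset.range n, (cdfSublevel μ u).indicator (1 : ℝ → ℝ) (ε i ω) - n * u

/-- The event that some dyadic increment of the centred counts at a level in `[m₀, M]` is large. -/
def largeDyadicIncrement {Ω : Type*} (ε : ℕ → Ω → ℝ) (μ : Measure ℝ) (n m₀ M : ℕ) : Set Ω :=
  ⋃ m ∈ Finset.Ico m₀ (M + 1), ⋃ j ∈ Finset.range (2 ^ m),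
    {ω | Real.sqrt n * (9 / 10) ^ m ≤
      |sublevelCount ε μ n ω (((j + 1 : ℕ) : ℝ) / 2 ^ m)
        - sublevelCount ε μ n ω ((j : ℝ) / 2 ^ m)|}

/-- Tail bound for a single dyadic increment. -/
lemma measureReal_dyadic_increment_le {Ω : Type*} [MeasurableSpace Ω] {P : Measure Ω}
    [IsProbabilityMeasure P] {ε : ℕ → Ω → ℝ} (hmeas : ∀ i, Measurable (ε i))
    (hindep : iIndepFun ε P) {μ : Measure ℝ} [IsProbabilityMeasure μ]
    (hident : ∀ i, P.map (ε i) = μ) (hcont : Continuous (cdf μ)) {n m j : ℕ}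
    (hn : 2 ^ m ≤ n) (hj : j < 2 ^ m) :
    P.real {ω | Real.sqrt n * (9 / 10) ^ m ≤
      |sublevelCount ε μ n ω (((j + 1 : ℕ) : ℝ) / 2 ^ m)
        - sublevelCount ε μ n ω ((j : ℝ) / 2 ^ m)|}
      ≤ 2 * Real.exp (1 - (9 / 10) ^ m * Real.sqrt (2 ^ m)) := by
  set u : ℝ := (j : ℝ) / 2 ^ m with hu
  set v : ℝ := ((j + 1 : ℕ) : ℝ) / 2 ^ m with hv
  have hNpos : (0 : ℝ) < 2 ^ m := by positivity
  have huv : v - u = 1 / 2 ^ m := by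
    rw [hu, hv]
    push_cast
    ring
  have hu0 : 0 ≤ u := by positivity
  have hle : u ≤ v := by
    have : (0 : ℝ) < 1 / 2 ^ m := by positivity
    linarith
  have hv1 : v ≤ 1 := by
    rw [hv, div_le_one hNpos]
    exact_mod_cast hj
  have hsub := cdfSublevel_mono μ hle
  set B := cdfSublevel μ v \ cdfSublevel μ u with hBdef
  have hB : MeasurableSet B :=
    (measurableSet_cdfSublevel μ v).diff (measurableSet_cdfSublevel μ u)
  have hμB : μ.real B = 1 / 2 ^ m := by
    rw [hBdef, measureReal_sdiff hsub (measurableSet_cdfSublevel μ u),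
      measureReal_cdfSublevel hcont (hu0.trans hle) hv1,
      measureReal_cdfSublevel hcont hu0 (hle.trans hv1), huv]
  have hn' : (2 : ℝ) ^ m ≤ n := by exact_mod_cast hn
  have hq : 1 ≤ (n : ℝ) * μ.real B := by
    rw [hμB, mul_one_div, one_le_div hNpos]
    exact hn'
  have key := measureReal_abs_count_sub_ge_le hmeas hindep hident hB n hq
    ((9 / 10) ^ m * Real.sqrt (2 ^ m))
  have e1 : (9 / 10) ^ m * Real.sqrt (2 ^ m) * Real.sqrt (n * μ.real B)
      = Real.sqrt n * (9 / 10 : ℝ) ^ m := by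
    rw [mul_assoc, ← Real.sqrt_mul (by positivity), hμB]
    have : (2 : ℝ) ^ m * (n * (1 / 2 ^ m)) = n := by field_simp
    rw [this, mul_comm]
  have e2 : ∀ ω, ∑ i ∈ Finset.range n, B.indicator (1 : ℝ → ℝ) (ε i ω) - n * μ.real B
      = sublevelCount ε μ n ω v - sublevelCount ε μ n ω u := by
    intro ω
    have hind : ∀ x, B.indicator (1 : ℝ → ℝ) x
        = (cdfSublevel μ v).indicator 1 x - (cdfSublevel μ u).indicator 1 x := by
      intro x
      rw [hBdef, Set.indicator_sdiff hsub]
      rfl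
    simp only [sublevelCount, hind, Finset.sum_sub_distrib, hμB, ← huv]
    ring
  simpa only [e1, e2] using key

/-- Union bound over all dyadic increments. -/
lemma measureReal_largeDyadicIncrement_le {Ω : Type*} [MeasurableSpace Ω] {P : Measure Ω}
    [IsProbabilityMeasure P] {ε : ℕ → Ω → ℝ} (hmeas : ∀ i, Measurable (ε i))
    (hindep : iIndepFun ε P) {μ : Measure ℝ} [IsProbabilityMeasure μ]
    (hident : ∀ i, P.map (ε i) = μ) (hcont : Continuous (cdf μ)) {n m₀ M : ℕ}
    (hn : 2 ^ M ≤ n) :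
    P.real (largeDyadicIncrement ε μ n m₀ M) ≤ 720 * (4 / 5) ^ m₀ := by
  have hterm : ∀ m ∈ Finset.Ico m₀ (M + 1),
      P.real (⋃ j ∈ Finset.range (2 ^ m), {ω | Real.sqrt n * (9 / 10) ^ m ≤
        |sublevelCount ε μ n ω (((j + 1 : ℕ) : ℝ) / 2 ^ m)
          - sublevelCount ε μ n ω ((j : ℝ) / 2 ^ m)|}) ≤ 144 * (4 / 5) ^ m := by
    intro m hm
    have hmM : 2 ^ m ≤ n :=
      (Nat.pow_le_pow_right (by norm_num) (by rw [Finset.mem_Ico] at hm; omega)).trans hn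
    refine (measureReal_biUnion_finset_le _ _).trans ?_
    refine (Finset.sum_le_card_nsmul _ _ _ fun j hj =>
      measureReal_dyadic_increment_le hmeas hindep hident hcont hmM
        (Finset.mem_range.1 hj)).trans ?_
    rw [Finset.card_range, nsmul_eq_mul]
    push_cast
    set x : ℝ := (9 / 10) ^ m * Real.sqrt (2 ^ m) with hx
    have hx0 : 0 < x := by positivity
    have hx4 : x ^ 4 = (6561 / 2500) ^ m := by
      rw [hx, mul_pow, show Real.sqrt (2 ^ m) ^ 4 = (Real.sqrt (2 ^ m) ^ 2) ^ 2 by ring,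
        Real.sq_sqrt (by positivity), ← pow_mul, ← pow_mul, mul_comm m 4, mul_comm m 2,
        pow_mul, pow_mul, ← mul_pow]
      norm_num
    have hfac := Real.pow_div_factorial_le_exp x hx0.le 4
    have he : Real.exp (1 - x) ≤ 72 / x ^ 4 := by
      rw [Real.exp_sub, div_le_div_iff₀ (Real.exp_pos _) (by positivity)]
      have h24 : x ^ 4 ≤ 24 * Real.exp x := by
        norm_num [Nat.factorial] at hfac
        linarith
      have h3 : Real.exp 1 ≤ 3 := Real.exp_one_lt_three.le
      have : 0 ≤ x ^ 4 := by positivity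
      nlinarith
    have h2 : (2 : ℝ) ^ m ≤ (4 / 5) ^ m * x ^ 4 := by
      rw [hx4, ← mul_pow]
      gcongr
      norm_num
    calc (2 : ℝ) ^ m * (2 * Real.exp (1 - x)) ≤ ((4 / 5) ^ m * x ^ 4) * (2 * (72 / x ^ 4)) := by
          gcongr
      _ = 144 * (4 / 5) ^ m := by
          field_simp
          norm_num
  refine (measureReal_biUnion_finset_le _ _).trans ((Finset.sum_le_sum hterm).trans ?_)
  rw [← Finset.mul_sum]
  have := geom_sum_Ico_le_of_lt_one (x := (4 / 5 : ℝ)) (m := m₀) (n := M + 1) (by norm_num)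
    (by norm_num)
  norm_num at this ⊢
  linarith

lemma empDF_mono {Ω : Type*} (ε : ℕ → Ω → ℝ) (n : ℕ) (ω : Ω) : Monotone (empDF ε n ω) := by
  intro s t hst
  unfold empDF
  gcongr with i _
  split_ifs <;> linarith

lemma empDF_nonneg {Ω : Type*} (ε : ℕ → Ω → ℝ) (n : ℕ) (ω : Ω) (t : ℝ) : 0 ≤ empDF ε n ω t := by
  unfold empDF
  positivity

lemma empDF_le_one {Ω : Type*} (ε : ℕ → Ω → ℝ) (n : ℕ) (ω : Ω) (t : ℝ) : empDF ε n ω t ≤ 1 := by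
  unfold empDF
  have h : ∑ i ∈ Finset.range n, (if ε i ω ≤ t then (1 : ℝ) else 0) ≤ n := by
    refine (Finset.sum_le_card_nsmul _ _ 1 fun i _ => ?_).trans (by simp)
    split_ifs <;> norm_num
  calc _ ≤ (n : ℝ)⁻¹ * n := by gcongr
    _ ≤ 1 := inv_mul_le_one

/-- Comparison of the centred empirical count at `t` with the dyadic grid. -/
lemma exists_grid_bracket {Ω : Type*} (ε : ℕ → Ω → ℝ) (μ : Measure ℝ) {n : ℕ} (hn : n ≠ 0)
    (ω : Ω) {N : ℕ} (hN : 0 < N) (t : ℝ) :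
    ∃ i : ℕ, i < N ∧ (i : ℝ) / N ≤ cdf μ t ∧ cdf μ t ≤ ((i + 1 : ℕ) : ℝ) / N ∧
      sublevelCount ε μ n ω ((i : ℝ) / N) - n / N ≤ n * (empDF ε n ω t - cdf μ t) ∧
      n * (empDF ε n ω t - cdf μ t) ≤ sublevelCount ε μ n ω (((i + 1 : ℕ) : ℝ) / N) + n / N := by
  have hN' : (0 : ℝ) < N := by exact_mod_cast hN
  have hn' : (n : ℝ) ≠ 0 := by exact_mod_cast hn
  have hF0 := cdf_nonneg μ t
  have hF1 := cdf_le_one μ t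
  obtain ⟨i, hiN, hlo, hup, hup'⟩ : ∃ i : ℕ, i < N ∧ (i : ℝ) / N ≤ cdf μ t ∧
      cdf μ t ≤ ((i + 1 : ℕ) : ℝ) / N ∧
      (cdf μ t < ((i + 1 : ℕ) : ℝ) / N ∨ (1 : ℝ) ≤ ((i + 1 : ℕ) : ℝ) / N) := by
    rcases hF1.eq_or_lt with h1 | h1
    · refine ⟨N - 1, by omega, ?_, ?_, Or.inr ?_⟩
      · rw [h1, div_le_one hN']
        exact_mod_cast Nat.sub_le N 1
      · rw [h1, Nat.sub_add_cancel hN, div_self hN'.ne']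
      · rw [Nat.sub_add_cancel hN, div_self hN'.ne']
    · have hlt : cdf μ t < ((⌊N * cdf μ t⌋₊ + 1 : ℕ) : ℝ) / N := by
        rw [lt_div_iff₀ hN', mul_comm]
        push_cast
        exact Nat.lt_floor_add_one _
      refine ⟨⌊N * cdf μ t⌋₊, ?_, ?_, hlt.le, Or.inl hlt⟩
      · rw [Nat.floor_lt (by positivity)]
        nlinarith
      · rw [div_le_iff₀ hN', mul_comm]
        exact Nat.floor_le (by positivity)
  have hemp : n * (empDF ε n ω t - cdf μ t)
      = ∑ i ∈ Finset.range n, (if ε i ω ≤ t then (1 : ℝ) else 0) - n * cdf μ t := by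
    unfold empDF
    rw [mul_sub, mul_inv_cancel_left₀ hn']
  have hstep : ((i + 1 : ℕ) : ℝ) / N = (i : ℝ) / N + 1 / N := by
    push_cast
    ring
  have hcl : ∑ j ∈ Finset.range n, (cdfSublevel μ ((i : ℝ) / N)).indicator (1 : ℝ → ℝ) (ε j ω)
      ≤ ∑ j ∈ Finset.range n, (if ε j ω ≤ t then (1 : ℝ) else 0) := by
    refine Finset.sum_le_sum fun j _ => ?_
    by_cases hj : ε j ω ∈ cdfSublevel μ ((i : ℝ) / N)
    · have : ε j ω ≤ t := by
        rcases mem_cdfSublevel.1 hj with hj | hj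
        · exact ((monotone_cdf μ).reflect_lt (hj.trans_le hlo)).le
        · rw [le_div_iff₀ hN', one_mul] at hj
          exact absurd (by exact_mod_cast hj) (not_le.2 hiN)
      simp [hj, this]
    · rw [Set.indicator_of_notMem hj]
      split_ifs <;> norm_num
  have hcu : ∑ j ∈ Finset.range n, (if ε j ω ≤ t then (1 : ℝ) else 0)
      ≤ ∑ j ∈ Finset.range n,
        (cdfSublevel μ (((i + 1 : ℕ) : ℝ) / N)).indicator (1 : ℝ → ℝ) (ε j ω) := by
    refine Finset.sum_le_sum fun j _ => ?_
    split_ifs with hj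
    · have : ε j ω ∈ cdfSublevel μ (((i + 1 : ℕ) : ℝ) / N) :=
        hup'.imp (fun h => (monotone_cdf μ hj).trans_lt h) id
      rw [Set.indicator_of_mem this, Pi.one_apply]
    · exact Set.indicator_nonneg (fun _ _ => zero_le_one) _
  refine ⟨i, hiN, hlo, hup, ?_, ?_⟩
  · rw [hemp, sublevelCount]
    have : (n : ℝ) * cdf μ t ≤ n * ((i : ℝ) / N + 1 / N) := by
      rw [← hstep]
      gcongr
    have e : (n : ℝ) * ((i : ℝ) / N + 1 / N) = n * ((i : ℝ) / N) + n / N := by ring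
    linarith
  · rw [hemp, sublevelCount, hstep]
    rw [hstep] at hcu
    have : (n : ℝ) * ((i : ℝ) / N) ≤ n * cdf μ t := by gcongr
    have e : (n : ℝ) * ((i : ℝ) / N + 1 / N) = n * ((i : ℝ) / N) + n / N := by ring
    linarith

/-- Off the event of large dyadic increments the empirical process oscillates little. -/
lemma abs_empirical_process_sub_le {Ω : Type*} {ε : ℕ → Ω → ℝ} {μ : Measure ℝ} {n m₀ D : ℕ}
    (hn : n ≠ 0) (hnM : n < 2 ^ (m₀ + D + 1)) (hD : 2 ≤ D) {ω : Ω}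
    (hω : ω ∉ largeDyadicIncrement ε μ n m₀ (m₀ + D)) {t t' : ℝ} (htt : t ≤ t')
    (hF : cdf μ t' - cdf μ t ≤ 1 / 2 ^ (m₀ + 1)) :
    |Real.sqrt n * (empDF ε n ω t' - cdf μ t') - Real.sqrt n * (empDF ε n ω t - cdf μ t)|
      ≤ 19 * (9 / 10) ^ m₀ + 4 / Real.sqrt n := by
  have hn' : (0 : ℝ) < n := by exact_mod_cast Nat.pos_of_ne_zero hn
  set r := Real.sqrt n with hr
  have hr0 : 0 < r := Real.sqrt_pos.2 hn'
  have hrr : r * r = n := Real.mul_self_sqrt hn'.le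
  set S := sublevelCount ε μ n ω with hS
  set N : ℕ := 2 ^ (m₀ + D) with hN
  have hNr : (N : ℝ) = 2 ^ (m₀ + D) := by
    rw [hN]
    push_cast
    rfl
  have hNpos : 0 < N := by positivity
  have hNpos' : (0 : ℝ) < N := by exact_mod_cast hNpos
  have hinc : ∀ m, m₀ ≤ m → m ≤ m₀ + D → ∀ j : ℕ, j < 2 ^ m →
      |S (((j + 1 : ℕ) : ℝ) / 2 ^ m) - S ((j : ℝ) / 2 ^ m)| ≤ r * (9 / 10) ^ m := by
    intro m h1 h2 j hj
    by_contra! hcon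
    refine hω ?_
    simp only [largeDyadicIncrement, Set.mem_iUnion]
    exact ⟨m, by simp; omega, j, by simpa using hj, hcon.le⟩
  have hchain : ∀ p q : ℕ, p ≤ N → q ≤ N → p ≤ q + 2 ^ D → q ≤ p + 2 ^ D →
      |S ((p : ℝ) / N) - S ((q : ℝ) / N)| ≤ 19 * r * (9 / 10) ^ m₀ := by
    intro p q hp hq hpq hqp
    rw [hNr]
    rcases le_total q p with h | h
    · exact abs_sub_le_of_dyadic_increments hinc hr0.le h hp hpq
    · rw [abs_sub_comm]
      exact abs_sub_le_of_dyadic_increments hinc hr0.le h hq hqp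
  obtain ⟨i, hiN, hi1, hi2, hi3, hi4⟩ := exists_grid_bracket ε μ hn ω hNpos t
  obtain ⟨i', hi'N, hi'1, hi'2, hi'3, hi'4⟩ := exists_grid_bracket ε μ hn ω hNpos t'
  have hmono := monotone_cdf μ htt
  have hii : i ≤ i' + 1 := by
    have := (div_le_div_iff_of_pos_right hNpos').1 ((hi1.trans hmono).trans hi'2)
    exact_mod_cast this
  have h2D : 2 * 2 ^ (D - 1) = 2 ^ D := by
    rw [← pow_succ']
    congr 1
    omega
  have h2D1 : 2 ≤ 2 ^ (D - 1) := by
    calc 2 = 2 ^ 1 := by norm_num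
      _ ≤ 2 ^ (D - 1) := Nat.pow_le_pow_right (by norm_num) (by omega)
  have hii' : i' ≤ i + 1 + 2 ^ (D - 1) := by
    have h1 : (i' : ℝ) / N ≤ ((i + 1 : ℕ) : ℝ) / N + 1 / 2 ^ (m₀ + 1) := by linarith
    have h2 : (N : ℝ) * (1 / 2 ^ (m₀ + 1)) = 2 ^ (D - 1) := by
      rw [hNr, show m₀ + D = (m₀ + 1) + (D - 1) by omega, pow_add]
      field_simp
    rw [div_le_iff₀ hNpos', add_mul, div_mul_cancel₀ _ hNpos'.ne', mul_comm _ (N : ℝ), h2] at h1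
    exact_mod_cast h1
  have hA := hchain (i' + 1) i (by omega) (by omega) (by omega) (by omega)
  have hB := hchain i' (i + 1) (by omega) (by omega) (by omega) (by omega)
  have hnN : (n : ℝ) / N ≤ 2 := by
    rw [div_le_iff₀ hNpos']
    rw [pow_succ] at hnM
    have : n ≤ 2 * N := by omega
    exact_mod_cast this
  rw [abs_le] at hA hB
  have hmain : |n * (empDF ε n ω t' - cdf μ t') - n * (empDF ε n ω t - cdf μ t)|
      ≤ 19 * r * (9 / 10) ^ m₀ + 4 := by
    rw [abs_le]
    constructor <;> linarith [hA.1, hA.2, hB.1, hB.2]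
  rw [← mul_le_mul_iff_right₀ hr0]
  calc _ = |n * (empDF ε n ω t' - cdf μ t') - n * (empDF ε n ω t - cdf μ t)| := by
        rw [← abs_of_pos hr0, ← abs_mul, abs_of_pos hr0, ← hrr]
        ring_nf
    _ ≤ _ := hmain
    _ = _ := by
        field_simp

/-- Averaging over the kernel: the smoothing error is at most the oscillation. -/
lemma abs_smoothing_error_le {H G k : ℝ → ℝ} (hH : Measurable H) (hG : Measurable G)
    (hHb : ∀ t, |H t| ≤ 1) (hGb : ∀ t, |G t| ≤ 1) (hk0 : ∀ x, 0 ≤ k x) (hkInt : Integrable k)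
    (hkdens : ∫ x, k x = 1) (hksupp : Function.support k ⊆ Set.Icc (-1) 1) {a r C t : ℝ}
    (hr : 0 ≤ r)
    (hC : ∀ s, |s| ≤ |a| → |r * (H (t + s) - G (t + s)) - r * (H t - G t)| ≤ C) :
    r * |(∫ x, H (t - a * x) * k x) - (∫ x, G (t - a * x) * k x) - H t + G t| ≤ C := by
  have hint : ∀ f : ℝ → ℝ, Measurable f → (∀ t, |f t| ≤ 1) →
      Integrable (fun x => f (t - a * x) * k x) := by
    intro f hf hfb
    exact hkInt.bdd_mul (c := 1) (hf.comp (by fun_prop)).aestronglyMeasurable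
      (ae_of_all _ fun x => hfb _)
  have e : r * ((∫ x, H (t - a * x) * k x) - (∫ x, G (t - a * x) * k x) - H t + G t)
      = ∫ x, (r * (H (t - a * x) - G (t - a * x)) - r * (H t - G t)) * k x := by
    have hfun : (fun x => (r * (H (t - a * x) - G (t - a * x)) - r * (H t - G t)) * k x)
        = fun x => r * ((H (t - a * x) * k x - G (t - a * x) * k x) - (H t - G t) * k x) := by
      funext x
      ring
    rw [hfun, integral_const_mul, integral_sub
      (by exact (hint H hH hHb).sub (hint G hG hGb)) (hkInt.const_mul _),
      integral_sub (hint H hH hHb) (hint G hG hGb), integral_const_mul,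
      hkdens]
    ring
  rw [← abs_of_nonneg hr, ← abs_mul, e]
  calc _ ≤ ∫ x, C * k x := by
        rw [← Real.norm_eq_abs]
        refine norm_integral_le_of_norm_le (hkInt.const_mul C) (ae_of_all _ fun x => ?_)
        rw [norm_mul, Real.norm_eq_abs, Real.norm_eq_abs, abs_of_nonneg (hk0 x)]
        by_cases hx : k x = 0
        · simp [hx]
        · have hx1 : |x| ≤ 1 := abs_le.2 (hksupp hx)
          have hs := hC (-(a * x)) (by
            rw [abs_neg, abs_mul]
            exact mul_le_of_le_one_right (abs_nonneg _) hx1)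
          rw [← sub_eq_add_neg] at hs
          exact mul_le_mul_of_nonneg_right hs (hk0 x)
    _ = C := by rw [integral_const_mul, hkdens, mul_one]

/-- Let `ε_1, …, ε_n` be i.i.d. with continuous distribution function
`F`, `𝔽` their empirical distribution function, `k` a probability density supported in
`[-1,1]`, and `F_a(t) = ∫ F(t-ax)k(x)dx`, `𝔽_a(t) = ∫ 𝔽(t-ax)k(x)dx`. If `a_n → 0` then
`G_n = n^{1/2} sup_t |𝔽_{a_n}(t) - F_{a_n}(t) - 𝔽(t) + F(t)| = o_p(1)`; moreover, with
`W_n = n^{1/2}(𝔽 - F)`, `G_n ≤ sup_t sup_{|s| ≤ |a_n|} |W_n(t+s) - W_n(t)|`. -/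
theorem smoothed_empirical_oscillation {Ω : Type*} [MeasurableSpace Ω] (P : Measure Ω)
    [IsProbabilityMeasure P]
    (ε : ℕ → Ω → ℝ) (hmeas : ∀ i, Measurable (ε i))
    (hindep : iIndepFun ε P)
    (hident : ∀ i, Measure.map (ε i) P = Measure.map (ε 0) P)
    (F : ℝ → ℝ) (hF : ∀ t, F t = (P {ω | ε 0 ω ≤ t}).toReal) (hFcont : Continuous F)
    (k : ℝ → ℝ) (hk0 : ∀ x, 0 ≤ k x) (hkInt : Integrable k) (hkdens : ∫ x, k x = 1)
    (hksupp : Function.support k ⊆ Set.Icc (-1) 1)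
    (a : ℕ → ℝ) (ha : Tendsto a atTop (nhds 0)) :
    (∀ η > 0, Tendsto (fun n : ℕ =>
        P {ω | Real.sqrt n * (⨆ t : ℝ,
          |(∫ x, empDF ε n ω (t - a n * x) * k x) - (∫ x, F (t - a n * x) * k x)
            - empDF ε n ω t + F t|) > η})
        atTop (nhds 0)) ∧
    (∀ n : ℕ, ∀ ω : Ω,
      Real.sqrt n * (⨆ t : ℝ,
          |(∫ x, empDF ε n ω (t - a n * x) * k x) - (∫ x, F (t - a n * x) * k x)
            - empDF ε n ω t + F t|)
        ≤ ⨆ t : ℝ, ⨆ s : {s : ℝ // |s| ≤ |a n|},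
            |Real.sqrt n * (empDF ε n ω (t + s) - F (t + s))
              - Real.sqrt n * (empDF ε n ω t - F t)|) := by
  have : IsProbabilityMeasure (P.map (ε 0)) :=
    Measure.isProbabilityMeasure_map (hmeas 0).aemeasurable
  set μ : Measure ℝ := P.map (ε 0) with hμ
  obtain rfl : F = cdf μ := by
    funext t
    rw [hF, cdf_eq_real, hμ, map_measureReal_apply (hmeas 0) measurableSet_Iic]
    rfl
  have hFb : ∀ t, |cdf μ t| ≤ 1 := fun t =>
    abs_le.2 ⟨by linarith [cdf_nonneg μ t], cdf_le_one μ t⟩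
  have hEb : ∀ n ω t, |empDF ε n ω t| ≤ 1 := fun n ω t =>
    abs_le.2 ⟨by linarith [empDF_nonneg ε n ω t], empDF_le_one ε n ω t⟩
  have hsmooth : ∀ (n : ℕ) (ω : Ω) (C : ℝ),
      (∀ t s : ℝ, |s| ≤ |a n| → |Real.sqrt n * (empDF ε n ω (t + s) - cdf μ (t + s))
        - Real.sqrt n * (empDF ε n ω t - cdf μ t)| ≤ C) →
      Real.sqrt n * (⨆ t : ℝ,
        |(∫ x, empDF ε n ω (t - a n * x) * k x) - (∫ x, cdf μ (t - a n * x) * k x)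
          - empDF ε n ω t + cdf μ t|) ≤ C := by
    intro n ω C hC
    rw [Real.mul_iSup_of_nonneg (Real.sqrt_nonneg _)]
    exact ciSup_le fun t => abs_smoothing_error_le (empDF_mono ε n ω).measurable
      (monotone_cdf μ).measurable (hEb n ω) hFb hk0 hkInt hkdens hksupp (Real.sqrt_nonneg _)
      (hC t)
  refine ⟨fun η hη => ?_, fun n ω => hsmooth n ω _ fun t s hs => ?_⟩
  · rw [ENNReal.tendsto_nhds_zero]
    intro δ hδ
    have hpow : Tendsto (fun m : ℕ => ENNReal.ofReal (720 * (4 / 5) ^ m)) atTop (nhds 0) := by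
      have := ENNReal.tendsto_ofReal ((tendsto_pow_atTop_nhds_zero_of_lt_one
        (r := (4 / 5 : ℝ)) (by norm_num) (by norm_num)).const_mul 720)
      simpa using this
    have hosc : Tendsto (fun m : ℕ => 19 * (9 / 10 : ℝ) ^ m) atTop (nhds 0) := by
      simpa using (tendsto_pow_atTop_nhds_zero_of_lt_one
        (r := (9 / 10 : ℝ)) (by norm_num) (by norm_num)).const_mul 19
    obtain ⟨m₀, hm₀, hm₀'⟩ := ((ENNReal.tendsto_nhds_zero.1 hpow δ hδ).and
      (hosc.eventually_le_const (half_pos hη))).exists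
    have hsqrt : Tendsto (fun n : ℕ => 4 / Real.sqrt n) atTop (nhds 0) :=
      (Real.tendsto_sqrt_atTop.comp tendsto_natCast_atTop_atTop).const_div_atTop 4
    obtain ⟨d, hd, hdF⟩ := Metric.uniformContinuous_iff.1 (uniformContinuous_cdf hFcont)
      (1 / 2 ^ (m₀ + 1)) (by positivity)
    have had : ∀ᶠ n in atTop, |a n| < d := by
      simpa [Real.dist_eq] using Metric.tendsto_nhds.1 ha d hd
    filter_upwards [hsqrt.eventually_le_const (half_pos hη), had,
      eventually_ge_atTop (2 ^ (m₀ + 2))] with n h4 hand hnbig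
    have hn0 : n ≠ 0 := by
      have : 0 < 2 ^ (m₀ + 2) := by positivity
      omega
    have hlog : m₀ + 2 ≤ Nat.log 2 n := Nat.le_log_of_pow_le (by norm_num) hnbig
    obtain ⟨D, hD⟩ := Nat.exists_eq_add_of_le (show m₀ ≤ Nat.log 2 n by omega)
    have hlow : 2 ^ (m₀ + D) ≤ n := hD ▸ Nat.pow_log_le_self 2 hn0
    have hhigh : n < 2 ^ (m₀ + D + 1) := hD ▸ Nat.lt_pow_succ_log_self (by norm_num) n
    have hsub : {ω | Real.sqrt n * (⨆ t : ℝ,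
          |(∫ x, empDF ε n ω (t - a n * x) * k x) - (∫ x, cdf μ (t - a n * x) * k x)
            - empDF ε n ω t + cdf μ t|) > η} ⊆ largeDyadicIncrement ε μ n m₀ (m₀ + D) := by
      intro ω hω
      by_contra hgood
      refine not_le.2 hω (hsmooth n ω η fun t s hs => ?_)
      have hFd : |cdf μ (t + s) - cdf μ t| < 1 / 2 ^ (m₀ + 1) := by
        refine hdF ?_
        rw [Real.dist_eq, add_sub_cancel_left]
        exact hs.trans_lt hand
      have hbound : 19 * (9 / 10 : ℝ) ^ m₀ + 4 / Real.sqrt n ≤ η := by linarith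
      refine le_trans ?_ hbound
      rcases le_total t (t + s) with hts | hts
      · exact abs_empirical_process_sub_le hn0 hhigh (by omega) hgood hts
          ((le_abs_self _).trans hFd.le)
      · rw [abs_sub_comm]
        rw [abs_sub_comm] at hFd
        exact abs_empirical_process_sub_le hn0 hhigh (by omega) hgood hts
          ((le_abs_self _).trans hFd.le)
    calc _ ≤ P (largeDyadicIncrement ε μ n m₀ (m₀ + D)) := measure_mono hsub
      _ = ENNReal.ofReal (P.real (largeDyadicIncrement ε μ n m₀ (m₀ + D))) := by simp
      _ ≤ ENNReal.ofReal (720 * (4 / 5) ^ m₀) := ENNReal.ofReal_le_ofReal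
          (measureReal_largeDyadicIncrement_le hmeas hindep hident hFcont hlow)
      _ ≤ δ := hm₀
  · have hb : ∀ t s : ℝ, |Real.sqrt n * (empDF ε n ω (t + s) - cdf μ (t + s))
        - Real.sqrt n * (empDF ε n ω t - cdf μ t)| ≤ Real.sqrt n * 4 := by
      intro t s
      rw [← mul_sub, abs_mul, abs_of_nonneg (Real.sqrt_nonneg _)]
      gcongr
      have h1 := abs_le.1 (hEb n ω t)
      have h2 := abs_le.1 (hEb n ω (t + s))
      have h3 := abs_le.1 (hFb t)
      have h4 := abs_le.1 (hFb (t + s))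
      rw [abs_le]
      constructor <;> linarith [h1.1, h1.2, h2.1, h2.2, h3.1, h3.2, h4.1, h4.2]
    have hne : Nonempty {s : ℝ // |s| ≤ |a n|} := ⟨⟨s, hs⟩⟩
    refine le_ciSup_of_le ⟨Real.sqrt n * 4, ?_⟩ t (le_ciSup_of_le ⟨Real.sqrt n * 4, ?_⟩
      (⟨s, hs⟩ : {s : ℝ // |s| ≤ |a n|}) le_rfl)
    · rintro _ ⟨t', rfl⟩
      exact ciSup_le fun s' => hb t' s'
    · rintro _ ⟨s', rfl⟩
      exact hb t s'
end

section
/- Let ε_1, …, ε_n be i.i.d. with Lipschitz density f, let φ be a Lipschitz continuous function with compact support contained in [−1,1], and let b_n be positive numbers with b_n → 0 and b_n^{−1} = O(n/log n). Then sup_{|x|≤n^{1/3}} | (1/(n b_n)) Σ_{j=1}^n φ((x − ε_j)/b_n) − ∫ f(x − b_n t) φ(t) dt | = O_p((log n/(n b_n))^{1/2}). -/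
open MeasureTheory ProbabilityTheory Filter

/-- A Lipschitz probability density is bounded. -/
theorem le_of_lipschitzWith_density {f : ℝ → ℝ} {L : NNReal} (hf : LipschitzWith L f)
    (hint : ∫⁻ x, ENNReal.ofReal (f x) ≤ 1) (x : ℝ) : f x ≤ L + 1 := by
  have hlow : ∀ y ∈ Set.Icc x (x + 1), ENNReal.ofReal (f x - L) ≤ ENNReal.ofReal (f y) := by
    intro y hy
    refine ENNReal.ofReal_le_ofReal ?_
    have h := hf.dist_le_mul x y
    rw [Real.dist_eq, Real.dist_eq] at h
    have hxy : |x - y| ≤ 1 := by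
      rw [abs_le]
      constructor <;> linarith [hy.1, hy.2]
    have hL : (L : ℝ) * |x - y| ≤ L := mul_le_of_le_one_right L.2 hxy
    linarith [le_abs_self (f x - f y)]
  have hle : ENNReal.ofReal (f x - L) ≤ 1 := by
    calc ENNReal.ofReal (f x - L)
        = ∫⁻ _ in Set.Icc x (x + 1), ENNReal.ofReal (f x - L) := by simp
      _ ≤ ∫⁻ y in Set.Icc x (x + 1), ENNReal.ofReal (f y) :=
          setLIntegral_mono' measurableSet_Icc hlow
      _ ≤ ∫⁻ y, ENNReal.ofReal (f y) := setLIntegral_le_lintegral _ _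
      _ ≤ 1 := hint
  have := ENNReal.ofReal_le_one.1 hle
  linarith

/-- The expectation of `g ((x - X) / h)` when `X` has density `f`. -/
theorem integral_comp_sub_div_of_density {Ω : Type*} [MeasurableSpace Ω] {P : Measure Ω}
    {X : Ω → ℝ} (hX : Measurable X) {f : ℝ → ℝ} (hf : Measurable f) (hf0 : ∀ x, 0 ≤ f x)
    (hdens : Measure.map X P = volume.withDensity fun x => ENNReal.ofReal (f x))
    {g : ℝ → ℝ} (hg : Measurable g) {h : ℝ} (hh : 0 < h) (x : ℝ) :
    ∫ ω, g ((x - X ω) / h) ∂P = h * ∫ t, f (x - h * t) * g t := by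
  have hmap : ∫ ω, g ((x - X ω) / h) ∂P = ∫ y, g ((x - y) / h) ∂(Measure.map X P) := by
    rw [integral_map hX.aemeasurable]
    exact (by fun_prop : Measurable fun y => g ((x - y) / h)).aestronglyMeasurable
  rw [hmap, hdens, integral_withDensity_eq_integral_toReal_smul (by fun_prop) (by simp)]
  simp only [ENNReal.toReal_ofReal (hf0 _), smul_eq_mul]
  have hscale := Measure.integral_comp_mul_left (fun u => f (x - u) * g (u / h)) h
  have hshift := integral_sub_left_eq_self (fun y => f y * g ((x - y) / h)) volume x
  simp only [sub_sub_cancel] at hshift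
  simp only [mul_div_cancel_left₀ _ hh.ne', smul_eq_mul, hshift, abs_of_pos (inv_pos.2 hh)]
    at hscale
  rw [hscale, mul_inv_cancel_left₀ hh.ne']

/-- Quadratic bound on the moment generating function of a bounded centred variable. -/
theorem mgf_le_exp_sq_mul {Ω : Type*} [MeasurableSpace Ω] {P : Measure Ω}
    [IsProbabilityMeasure P] {X : Ω → ℝ} (hX : Measurable X) {K V s : ℝ}
    (hK : ∀ ω, |X ω| ≤ K) (hmean : ∫ ω, X ω ∂P = 0) (hV : ∫ ω, X ω ^ 2 ∂P ≤ V)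
    (hs : |s| * K ≤ 1) : mgf X P s ≤ Real.exp (s ^ 2 * V) := by
  have hK2 : ∀ ω, |X ω ^ 2| ≤ K ^ 2 := fun ω => by
    rw [abs_pow]; exact pow_le_pow_left₀ (abs_nonneg _) (hK ω) 2
  have iX : Integrable X P :=
    .of_bound hX.aestronglyMeasurable K (.of_forall hK)
  have iX2 : Integrable (fun ω => X ω ^ 2) P :=
    .of_bound (hX.pow_const 2).aestronglyMeasurable (K ^ 2) (.of_forall hK2)
  have hexp : ∀ ω, Real.exp (s * X ω) ≤ 1 + s * X ω + s ^ 2 * X ω ^ 2 := fun ω => by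
    have h1 : |s * X ω| ≤ 1 := by
      rw [abs_mul]
      exact (mul_le_mul_of_nonneg_left (hK ω) (abs_nonneg s)).trans hs
    have := (abs_le.1 (Real.abs_exp_sub_one_sub_id_le h1)).2
    rw [mul_pow] at this
    linarith
  have i1 : Integrable (fun ω => 1 + s * X ω) P := (integrable_const 1).add (iX.const_mul s)
  calc mgf X P s ≤ ∫ ω, (1 + s * X ω + s ^ 2 * X ω ^ 2) ∂P :=
        integral_mono_of_nonneg (.of_forall fun _ => (Real.exp_pos _).le)
          (i1.add (iX2.const_mul _)) (.of_forall hexp)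
    _ = 1 + s ^ 2 * ∫ ω, X ω ^ 2 ∂P := by
        rw [integral_add i1 (iX2.const_mul _), integral_add (integrable_const 1) (iX.const_mul s),
          integral_const_mul, integral_const_mul, hmean]
        simp
    _ ≤ 1 + s ^ 2 * V := by gcongr
    _ ≤ Real.exp (s ^ 2 * V) := by linarith [Real.add_one_le_exp (s ^ 2 * V)]

/-- One-sided Bernstein-type bound for sums of independent bounded centred variables. -/
theorem measureReal_sum_ge_le_exp {Ω : Type*} [MeasurableSpace Ω] {P : Measure Ω}
    [IsProbabilityMeasure P] {X : ℕ → Ω → ℝ} (hX : ∀ i, Measurable (X i)) (hind : iIndepFun X P)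
    {K V s : ℝ} (hK : ∀ i ω, |X i ω| ≤ K) (hmean : ∀ i, ∫ ω, X i ω ∂P = 0)
    (hV : ∀ i, ∫ ω, X i ω ^ 2 ∂P ≤ V) (hs0 : 0 ≤ s) (hs : s * K ≤ 1) (n : ℕ) (t : ℝ) :
    P.real {ω | t ≤ ∑ i ∈ Finset.range n, X i ω} ≤ Real.exp (-(s * t) + n * (s ^ 2 * V)) := by
  have hS : Measurable (∑ i ∈ Finset.range n, X i) := by fun_prop
  have hbound : ∀ ω, |(∑ i ∈ Finset.range n, X i) ω| ≤ n * K := fun ω => by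
    rw [Finset.sum_apply]
    refine (Finset.abs_sum_le_sum_abs _ _).trans ?_
    simpa using Finset.sum_le_sum fun i (_ : i ∈ Finset.range n) => hK i ω
  have hexp : Integrable (fun ω => Real.exp (s * (∑ i ∈ Finset.range n, X i) ω)) P := by
    refine .of_bound (by fun_prop) (Real.exp (s * (n * K))) (.of_forall fun ω => ?_)
    rw [Real.norm_eq_abs, Real.abs_exp]
    gcongr
    exact (le_abs_self _).trans (hbound ω)
  have h := measure_ge_le_exp_mul_mgf t hs0 hexp
  rw [hind.mgf_sum hX] at h
  simp only [Finset.sum_apply] at h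
  refine h.trans ?_
  rw [Real.exp_add, Real.exp_nat_mul, neg_mul]
  gcongr
  calc ∏ i ∈ Finset.range n, mgf (X i) P s
      ≤ ∏ _i ∈ Finset.range n, Real.exp (s ^ 2 * V) :=
        Finset.prod_le_prod (fun _ _ => mgf_nonneg) fun i _ =>
          mgf_le_exp_sq_mul (hX i) (hK i) (hmean i) (hV i) (by rwa [abs_of_nonneg hs0])
    _ = Real.exp (s ^ 2 * V) ^ n := by simp

/-- Two-sided Bernstein-type bound for sums of independent bounded centred variables. -/
theorem measureReal_abs_sum_ge_le_exp {Ω : Type*} [MeasurableSpace Ω] {P : Measure Ω}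
    [IsProbabilityMeasure P] {X : ℕ → Ω → ℝ} (hX : ∀ i, Measurable (X i)) (hind : iIndepFun X P)
    {K V s : ℝ} (hK : ∀ i ω, |X i ω| ≤ K) (hmean : ∀ i, ∫ ω, X i ω ∂P = 0)
    (hV : ∀ i, ∫ ω, X i ω ^ 2 ∂P ≤ V) (hs0 : 0 ≤ s) (hs : s * K ≤ 1) (n : ℕ) (t : ℝ) :
    P.real {ω | t ≤ |∑ i ∈ Finset.range n, X i ω|} ≤
      2 * Real.exp (-(s * t) + n * (s ^ 2 * V)) := by
  have hpos := measureReal_sum_ge_le_exp hX hind hK hmean hV hs0 hs n t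
  have hneg := measureReal_sum_ge_le_exp (X := fun i ω => -X i ω) (fun i => (hX i).neg)
    (hind.comp (fun _ y => -y) fun _ => measurable_neg) (by simpa using hK)
    (fun i => by rw [integral_neg, hmean i, neg_zero]) (by simpa using hV) hs0 hs n t
  have hsub : {ω | t ≤ |∑ i ∈ Finset.range n, X i ω|} ⊆
      {ω | t ≤ ∑ i ∈ Finset.range n, X i ω} ∪ {ω | t ≤ ∑ i ∈ Finset.range n, -X i ω} := by
    intro ω hω
    rcases le_abs.1 (show t ≤ |∑ i ∈ Finset.range n, X i ω| from hω) with h | h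
    · exact Or.inl h
    · exact Or.inr (h.trans_eq (Finset.sum_neg_distrib _).symm)
  linarith [measureReal_mono (μ := P) hsub, measureReal_union_le (μ := P)
    {ω | t ≤ ∑ i ∈ Finset.range n, X i ω} {ω | t ≤ ∑ i ∈ Finset.range n, -X i ω}]

/-- The deviation of the kernel sum with bandwidth `h` at `x` from its expectation. -/
noncomputable def kernelDeviation {Ω : Type*} (ε : ℕ → Ω → ℝ) (f φ : ℝ → ℝ) (n : ℕ) (h x : ℝ)
    (ω : Ω) : ℝ :=
  ((n : ℝ) * h)⁻¹ * (∑ j ∈ Finset.range n, φ ((x - ε j ω) / h)) - ∫ t, f (x - h * t) * φ t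

/-- A bounded nonnegative weight preserves integrability. -/
theorem integrable_mul_of_le {f g : ℝ → ℝ} (hf : Measurable f) (hf0 : ∀ x, 0 ≤ f x) {F : ℝ}
    (hF : ∀ x, f x ≤ F) (hg : Integrable g) (h x : ℝ) :
    Integrable fun t => f (x - h * t) * g t := by
  refine hg.bdd_mul (c := F)
    (by fun_prop : Measurable fun t => f (x - h * t)).aestronglyMeasurable (.of_forall fun t => ?_)
  rw [Real.norm_eq_abs, abs_of_nonneg (hf0 _)]
  exact hF _

/-- The kernel deviation is Lipschitz in the evaluation point, uniformly in the sample. -/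
theorem abs_kernelDeviation_sub_le {Ω : Type*} (ε : ℕ → Ω → ℝ) {f φ : ℝ → ℝ} {Lf Lφ : NNReal}
    (hf : LipschitzWith Lf f) (hf0 : ∀ x, 0 ≤ f x) {F : ℝ} (hF : ∀ x, f x ≤ F)
    (hφ : LipschitzWith Lφ φ) (hφi : Integrable φ) {n : ℕ} (hn : 0 < n) {h : ℝ} (hh : 0 < h)
    (x y : ℝ) (ω : Ω) :
    |kernelDeviation ε f φ n h x ω - kernelDeviation ε f φ n h y ω| ≤
      (Lφ * h⁻¹ ^ 2 + Lf * ∫ t, |φ t|) * |x - y| := by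
  have hn' : (0 : ℝ) < n := by exact_mod_cast hn
  have hsum : |((n : ℝ) * h)⁻¹ * (∑ j ∈ Finset.range n, φ ((x - ε j ω) / h)) -
      ((n : ℝ) * h)⁻¹ * (∑ j ∈ Finset.range n, φ ((y - ε j ω) / h))| ≤
      Lφ * h⁻¹ ^ 2 * |x - y| := by
    rw [← mul_sub, ← Finset.sum_sub_distrib, abs_mul, abs_of_pos (by positivity)]
    have hterm : ∀ j ∈ Finset.range n,
        |φ ((x - ε j ω) / h) - φ ((y - ε j ω) / h)| ≤ Lφ * (|x - y| / h) := fun j _ => by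
      have := hφ.dist_le_mul ((x - ε j ω) / h) ((y - ε j ω) / h)
      rwa [Real.dist_eq, Real.dist_eq, ← sub_div, sub_sub_sub_cancel_right, abs_div,
        abs_of_pos hh] at this
    calc ((n : ℝ) * h)⁻¹ * |∑ j ∈ Finset.range n, (φ ((x - ε j ω) / h) - φ ((y - ε j ω) / h))|
        ≤ ((n : ℝ) * h)⁻¹ * ∑ _j ∈ Finset.range n, Lφ * (|x - y| / h) := by
          gcongr
          exact (Finset.abs_sum_le_sum_abs _ _).trans (Finset.sum_le_sum hterm)
      _ = Lφ * h⁻¹ ^ 2 * |x - y| := by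
          rw [Finset.sum_const, Finset.card_range, nsmul_eq_mul]
          field_simp
  have hint : |(∫ t, f (x - h * t) * φ t) - ∫ t, f (y - h * t) * φ t| ≤
      (Lf * ∫ t, |φ t|) * |x - y| := by
    have hfm := hf.continuous.measurable
    rw [← integral_sub (integrable_mul_of_le hfm hf0 hF hφi h x)
      (integrable_mul_of_le hfm hf0 hF hφi h y)]
    calc |∫ t, (f (x - h * t) * φ t - f (y - h * t) * φ t)|
        ≤ ∫ t, (Lf * |x - y|) * |φ t| := by
          rw [← Real.norm_eq_abs]
          refine norm_integral_le_of_norm_le (hφi.abs.const_mul (Lf * |x - y|))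
            (.of_forall fun t => ?_)
          rw [← sub_mul, norm_mul, Real.norm_eq_abs, Real.norm_eq_abs]
          have := hf.dist_le_mul (x - h * t) (y - h * t)
          rw [Real.dist_eq, Real.dist_eq, sub_sub_sub_cancel_right] at this
          gcongr
      _ = (Lf * ∫ t, |φ t|) * |x - y| := by
          rw [integral_const_mul]
          ring
  rw [kernelDeviation, kernelDeviation, sub_sub_sub_comm, add_mul]
  exact (abs_sub _ _).trans (add_le_add hsum hint)

/-- Exponential tail bound for the kernel deviation at a fixed point. -/
theorem measureReal_abs_kernelDeviation_ge_le {Ω : Type*} [MeasurableSpace Ω] {P : Measure Ω}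
    [IsProbabilityMeasure P] {ε : ℕ → Ω → ℝ} (hmeas : ∀ i, Measurable (ε i))
    (hindep : iIndepFun ε P) {f : ℝ → ℝ} (hf : Measurable f) (hf0 : ∀ x, 0 ≤ f x)
    (hdens : ∀ i, Measure.map (ε i) P = volume.withDensity fun x => ENNReal.ofReal (f x))
    {F : ℝ} (hF : ∀ x, f x ≤ F) {φ : ℝ → ℝ} (hφ : Measurable φ)
    (hφ2 : Integrable fun t => φ t ^ 2) {B : ℝ} (hB : ∀ t, |φ t| ≤ B) {n : ℕ} (hn : 0 < n)
    {h : ℝ} (hh : 0 < h) {s : ℝ} (hs0 : 0 ≤ s) (hs : s * (2 * B) ≤ 1) (x u : ℝ) :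
    P.real {ω | u ≤ |kernelDeviation ε f φ n h x ω|} ≤
      2 * Real.exp (-(s * (n * h * u)) + n * (s ^ 2 * (h * (F * ∫ t, φ t ^ 2)))) := by
  have hn' : (0 : ℝ) < n := by exact_mod_cast hn
  set m : ℝ := h * ∫ t, f (x - h * t) * φ t with hm
  have hYm : ∀ i, Measurable fun ω => φ ((x - ε i ω) / h) := fun i => by
    have := hmeas i
    fun_prop
  have hYi : ∀ i, Integrable (fun ω => φ ((x - ε i ω) / h)) P := fun i =>
    .of_bound (hYm i).aestronglyMeasurable B (.of_forall fun _ => hB _)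
  have hmean : ∀ i, ∫ ω, φ ((x - ε i ω) / h) ∂P = m := fun i =>
    integral_comp_sub_div_of_density (hmeas i) hf hf0 (hdens i) hφ hh x
  have hmB : |m| ≤ B := by
    rw [← hmean 0]
    simpa using norm_integral_le_of_norm_le_const (μ := P)
      (f := fun ω => φ ((x - ε 0 ω) / h)) (.of_forall fun ω => hB _)
  have hsq : ∀ i, ∫ ω, (φ ((x - ε i ω) / h) - m) ^ 2 ∂P ≤ h * (F * ∫ t, φ t ^ 2) := fun i => by
    calc ∫ ω, (φ ((x - ε i ω) / h) - m) ^ 2 ∂P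
        = Var[fun ω => φ ((x - ε i ω) / h); P] := by
          rw [variance_eq_integral (hYm i).aemeasurable, hmean i]
      _ ≤ ∫ ω, φ ((x - ε i ω) / h) ^ 2 ∂P :=
          variance_le_expectation_sq (hYm i).aestronglyMeasurable
      _ = h * ∫ t, f (x - h * t) * φ t ^ 2 :=
          integral_comp_sub_div_of_density (hmeas i) hf hf0 (hdens i) (hφ.pow_const 2) hh x
      _ ≤ h * (F * ∫ t, φ t ^ 2) := by
          rw [← integral_const_mul F]
          refine mul_le_mul_of_nonneg_left (integral_mono
            (integrable_mul_of_le hf hf0 hF hφ2 h x) (hφ2.const_mul F) fun t => ?_) hh.le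
          exact mul_le_mul_of_nonneg_right (hF _) (sq_nonneg _)
  have hbern := measureReal_abs_sum_ge_le_exp (P := P) (X := fun i ω => φ ((x - ε i ω) / h) - m)
    (fun i => (hYm i).sub_const m)
    (hindep.comp (fun _ y => φ ((x - y) / h) - m) fun _ => by fun_prop)
    (K := 2 * B) (fun i ω => (abs_sub _ _).trans (by linarith [hB ((x - ε i ω) / h)]))
    (fun i => by rw [integral_sub (hYi i) (integrable_const m), hmean i]; simp)
    hsq hs0 hs n (n * h * u)
  refine (measureReal_mono fun ω hω => ?_).trans hbern
  have hrel : ∑ i ∈ Finset.range n, (φ ((x - ε i ω) / h) - m) =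
      n * h * kernelDeviation ε f φ n h x ω := by
    rw [kernelDeviation, Finset.sum_sub_distrib, Finset.sum_const, Finset.card_range,
      nsmul_eq_mul, hm]
    field_simp
  change n * h * u ≤ |∑ i ∈ Finset.range n, (φ ((x - ε i ω) / h) - m)|
  rw [hrel, abs_mul, abs_of_pos (by positivity : 0 < n * h)]
  exact mul_le_mul_of_nonneg_left hω (by positivity)

/-- Approximation of a point of `[-N, N]` by the grid `N⁻³ ℤ`. -/
theorem exists_grid_point {N : ℕ} (hN : 0 < N) {x : ℝ} (hx : |x| ≤ N) :
    ∃ k ∈ Finset.Icc (-(N : ℤ) ^ 4) ((N : ℤ) ^ 4), |x - k / (N : ℝ) ^ 3| ≤ ((N : ℝ) ^ 3)⁻¹ := by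
  have hN' : (0 : ℝ) < (N : ℝ) ^ 3 := by positivity
  obtain ⟨hlo, hhi⟩ := abs_le.1 hx
  refine ⟨⌊x * (N : ℝ) ^ 3⌋, Finset.mem_Icc.2 ⟨Int.le_floor.2 ?_, ?_⟩, ?_⟩
  · push_cast
    nlinarith
  · have : x * (N : ℝ) ^ 3 ≤ (((N : ℤ) ^ 4 : ℤ) : ℝ) := by
      push_cast
      nlinarith
    exact_mod_cast (Int.floor_le _).trans this
  · have h1 := Int.floor_le (x * (N : ℝ) ^ 3)
    have h2 := (Int.lt_floor_add_one (x * (N : ℝ) ^ 3)).le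
    rw [show x - ⌊x * (N : ℝ) ^ 3⌋ / (N : ℝ) ^ 3 =
      (x * (N : ℝ) ^ 3 - ⌊x * (N : ℝ) ^ 3⌋) * ((N : ℝ) ^ 3)⁻¹ by field_simp, abs_mul,
      abs_of_pos (inv_pos.2 hN'), abs_of_nonneg (by linarith)]
    exact mul_le_of_le_one_left (inv_pos.2 hN').le (by linarith)

/-- Union bound over a grid of `2 N ^ 4 + 1` points whose events have probability `O(N⁻⁵)`. -/
theorem measure_le_of_subset_grid {Ω : Type*} [MeasurableSpace Ω] {P : Measure Ω}
    [IsProbabilityMeasure P] {N : ℕ} (hN : 0 < N) {A : Set Ω} {E : ℤ → Set Ω}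
    (hA : A ⊆ ⋃ k ∈ Finset.Icc (-(N : ℤ) ^ 4) ((N : ℤ) ^ 4), E k)
    (hE : ∀ k, P.real (E k) ≤ 2 * ((N : ℝ) ^ 5)⁻¹) :
    P A ≤ ENNReal.ofReal (6 * (N : ℝ)⁻¹) := by
  have hcard : ((Finset.Icc (-(N : ℤ) ^ 4) ((N : ℤ) ^ 4)).card : ℝ) = 2 * (N : ℝ) ^ 4 + 1 := by
    have : ((Finset.Icc (-(N : ℤ) ^ 4) ((N : ℤ) ^ 4)).card : ℤ) = 2 * (N : ℤ) ^ 4 + 1 := by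
      rw [Int.card_Icc, Int.toNat_of_nonneg (by linarith [pow_nonneg (Int.natCast_nonneg N) 4])]
      ring
    exact_mod_cast this
  have hN1 : (1 : ℝ) ≤ (N : ℝ) ^ 4 := one_le_pow₀ (by exact_mod_cast hN)
  rw [← ofReal_measureReal]
  refine ENNReal.ofReal_le_ofReal ?_
  calc P.real A ≤ P.real (⋃ k ∈ Finset.Icc (-(N : ℤ) ^ 4) ((N : ℤ) ^ 4), E k) :=
        measureReal_mono hA (measure_ne_top _ _)
    _ ≤ ∑ k ∈ Finset.Icc (-(N : ℤ) ^ 4) ((N : ℤ) ^ 4), P.real (E k) :=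
        measureReal_biUnion_finset_le _ _
    _ ≤ ∑ _k ∈ Finset.Icc (-(N : ℤ) ^ 4) ((N : ℤ) ^ 4), 2 * ((N : ℝ) ^ 5)⁻¹ :=
        Finset.sum_le_sum fun k _ => hE k
    _ = (2 * (N : ℝ) ^ 4 + 1) * (2 * ((N : ℝ) ^ 5)⁻¹) := by
        rw [Finset.sum_const, nsmul_eq_mul, hcard]
    _ ≤ (3 * (N : ℝ) ^ 4) * (2 * ((N : ℝ) ^ 5)⁻¹) := by gcongr; linarith
    _ = 6 * (N : ℝ)⁻¹ := by field_simp; norm_num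

/-- Bound on the probability that the kernel deviation is large somewhere on
`[-n ^ (1 / 3), n ^ (1 / 3)]`. -/
theorem measure_iSup_abs_kernelDeviation_gt_le {Ω : Type*} [MeasurableSpace Ω] {P : Measure Ω}
    [IsProbabilityMeasure P] {ε : ℕ → Ω → ℝ} (hmeas : ∀ i, Measurable (ε i))
    (hindep : iIndepFun ε P) {f φ : ℝ → ℝ} {Lf Lφ : NNReal} (hf : LipschitzWith Lf f)
    (hf0 : ∀ x, 0 ≤ f x)
    (hdens : ∀ i, Measure.map (ε i) P = volume.withDensity fun x => ENNReal.ofReal (f x))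
    {F : ℝ} (hF : ∀ x, f x ≤ F) (hφ : LipschitzWith Lφ φ) (hφi : Integrable φ)
    (hφ2 : Integrable fun t => φ t ^ 2) {B : ℝ} (hBpos : 0 < B) (hB : ∀ t, |φ t| ≤ B)
    {C c M₁ M₂ : ℝ} (hCpos : 0 < C) (hc : c = (2 * B * Real.sqrt C)⁻¹)
    (hM₁ : M₁ = 5 / c + c * (F * ∫ t, φ t ^ 2)) (hM₂ : M₂ = Lφ * C ^ 2 + Lf * ∫ t, |φ t|)
    {n : ℕ} (hn : 3 ≤ n) {h : ℝ} (hh : 0 < h) (hh1 : h ≤ 1) (hC : h⁻¹ ≤ C * n / Real.log n) :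
    P {ω | (⨆ x : {x : ℝ // |x| ≤ (n : ℝ) ^ ((1 : ℝ) / 3)}, |kernelDeviation ε f φ n h x ω|)
        > (M₁ + M₂) * (Real.log n / ((n : ℝ) * h)) ^ ((1 : ℝ) / 2)} ≤
      ENNReal.ofReal (6 * (n : ℝ)⁻¹) := by
  have hcpos : 0 < c := by rw [hc]; positivity
  have hI : 0 ≤ ∫ t, |φ t| := integral_nonneg fun _ => abs_nonneg _
  have hM₂0 : 0 ≤ M₂ := by rw [hM₂]; positivity
  generalize hIdef : ∫ t, |φ t| = I at *
  generalize hQdef : ∫ t, φ t ^ 2 = Q at *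
  have hn0 : 0 < n := by omega
  have hn1 : (1 : ℝ) ≤ n := by exact_mod_cast hn0
  have hnpos : (0 : ℝ) < n := by linarith
  have hlog : 1 ≤ Real.log n := by
    rw [Real.le_log_iff_exp_le hnpos]
    exact Real.exp_one_lt_three.le.trans (by exact_mod_cast hn)
  rw [← Real.sqrt_eq_rpow]
  set r : ℝ := Real.sqrt (Real.log n / (n * h))
  have hr2 : r ^ 2 = Real.log n / (n * h) := Real.sq_sqrt (by positivity)
  have hr0 : 0 ≤ r := Real.sqrt_nonneg _
  have hinv : h⁻¹ ≤ C * n := hC.trans (div_le_self (by positivity) hlog)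
  have hrC : r ≤ Real.sqrt C := by
    refine Real.sqrt_le_sqrt ?_
    rw [div_le_iff₀ (by positivity)]
    rw [le_div_iff₀ (by positivity), inv_mul_le_iff₀ hh] at hC
    linarith
  have hrn : (n : ℝ)⁻¹ ≤ r := by
    refine Real.le_sqrt_of_sq_le ?_
    rw [le_div_iff₀ (by positivity)]
    have : (n : ℝ)⁻¹ ^ 2 * (n * h) = (n : ℝ)⁻¹ * h := by field_simp
    rw [this]
    exact (mul_le_one₀ (inv_le_one_of_one_le₀ hn1) hh.le hh1).trans hlog
  refine measure_le_of_subset_grid hn0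
    (E := fun k => {ω | M₁ * r ≤ |kernelDeviation ε f φ n h (k / (n : ℝ) ^ 3) ω|})
    (fun ω hω => ?_) fun k => ?_
  · have hex : ∃ x : {x : ℝ // |x| ≤ (n : ℝ) ^ ((1 : ℝ) / 3)},
        (M₁ + M₂) * r < |kernelDeviation ε f φ n h x ω| := by
      by_contra! hcon
      have : Nonempty {x : ℝ // |x| ≤ (n : ℝ) ^ ((1 : ℝ) / 3)} :=
        ⟨0, by rw [abs_zero]; positivity⟩
      exact absurd hω (not_lt.2 (ciSup_le hcon))
    obtain ⟨⟨x, hx⟩, hxr⟩ := hex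
    have hxn : |x| ≤ n := hx.trans
      ((Real.rpow_le_rpow_of_exponent_le hn1 (by norm_num)).trans_eq (Real.rpow_one _))
    obtain ⟨k, hk, hxk⟩ := exists_grid_point hn0 hxn
    refine Set.mem_iUnion₂.2 ⟨k, hk, ?_⟩
    have hlip := abs_kernelDeviation_sub_le ε hf hf0 hF hφ hφi hn0 hh x (k / (n : ℝ) ^ 3) ω
    rw [hIdef] at hlip
    have hM : (Lφ * h⁻¹ ^ 2 + Lf * I) * |x - k / (n : ℝ) ^ 3| ≤ M₂ * r := by
      calc (Lφ * h⁻¹ ^ 2 + Lf * I) * |x - k / (n : ℝ) ^ 3|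
          ≤ (Lφ * (C * n) ^ 2 + (Lf * I) * (n : ℝ) ^ 2) * ((n : ℝ) ^ 3)⁻¹ := by
            have hI' : Lf * I ≤ (Lf * I) * (n : ℝ) ^ 2 :=
              le_mul_of_one_le_right (by positivity) (one_le_pow₀ hn1)
            gcongr
        _ = M₂ * (n : ℝ)⁻¹ := by
            rw [hM₂]
            field_simp
        _ ≤ M₂ * r := by gcongr
    have htri := abs_sub_abs_le_abs_sub (kernelDeviation ε f φ n h x ω)
      (kernelDeviation ε f φ n h (k / (n : ℝ) ^ 3) ω)
    change M₁ * r ≤ |kernelDeviation ε f φ n h (k / (n : ℝ) ^ 3) ω|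
    linarith
  · have hs : c * r * (2 * B) ≤ 1 := by
      calc c * r * (2 * B) ≤ c * Real.sqrt C * (2 * B) := by gcongr
        _ = 1 := by rw [hc]; field_simp
    refine (measureReal_abs_kernelDeviation_ge_le hmeas hindep hf.continuous.measurable hf0 hdens
      hF hφ.continuous.measurable hφ2 hB hn0 hh (by positivity) hs (k / (n : ℝ) ^ 3)
      (M₁ * r)).trans_eq ?_
    have hnbr : n * h * r ^ 2 = Real.log n := by
      rw [hr2]
      field_simp
    have hexp : -(c * r * (n * h * (M₁ * r))) + n * ((c * r) ^ 2 * (h * (F * Q))) =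
        -((5 : ℕ) * Real.log n) := by
      have hcM : c * M₁ = 5 + c ^ 2 * (F * Q) := by rw [hM₁]; field_simp
      linear_combination (c ^ 2 * (F * Q) - c * M₁) * hnbr - Real.log n * hcM
    rw [hQdef, hexp, Real.exp_neg, Real.exp_nat_mul, Real.exp_log hnpos]

/-- display (fe1): Let `ε_1, …, ε_n` be i.i.d. with Lipschitz density
`f`, let `φ` be Lipschitz with compact support in `[-1,1]`, and let `b_n > 0` with
`b_n → 0` and `b_n⁻¹ = O(n / log n)`. Then
`sup_{|x| ≤ n^{1/3}} |(1/(n b_n)) Σ_j φ((x - ε_j)/b_n) - ∫ f(x - b_n t) φ(t) dt|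
  = O_p((log n / (n b_n))^{1/2})`. -/
theorem kernel_estimator_uniform_rate {Ω : Type*} [MeasurableSpace Ω] (P : Measure Ω)
    [IsProbabilityMeasure P]
    (ε : ℕ → Ω → ℝ) (hmeas : ∀ i, Measurable (ε i))
    (hindep : iIndepFun ε P)
    (hident : ∀ i, Measure.map (ε i) P = Measure.map (ε 0) P)
    (f : ℝ → ℝ) (hf0 : ∀ x, 0 ≤ f x)
    (hfdens : Measure.map (ε 0) P = volume.withDensity fun x => ENNReal.ofReal (f x))
    (hfLip : ∃ L : NNReal, LipschitzWith L f)
    (φ : ℝ → ℝ) (hφLip : ∃ L : NNReal, LipschitzWith L φ)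
    (hφsupp : Function.support φ ⊆ Set.Icc (-1) 1)
    (b : ℕ → ℝ) (hbpos : ∀ n, 0 < b n) (hb0 : Tendsto b atTop (nhds 0))
    (hbO : ∃ C : ℝ, ∀ n : ℕ, 2 ≤ n → (b n)⁻¹ ≤ C * n / Real.log n) :
    ∀ δ > (0 : ℝ), ∃ M : ℝ, Filter.limsup (fun n : ℕ =>
        P {ω | (⨆ x : {x : ℝ // |x| ≤ (n : ℝ) ^ ((1 : ℝ) / 3)},
            |((n : ℝ) * b n)⁻¹ * (∑ j ∈ Finset.range n, φ (((x : ℝ) - ε j ω) / b n))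
              - ∫ t, f ((x : ℝ) - b n * t) * φ t|)
          > M * (Real.log n / ((n : ℝ) * b n)) ^ ((1 : ℝ) / 2)})
      atTop < ENNReal.ofReal δ := by
  intro δ hδ
  obtain ⟨Lf, hf⟩ := hfLip
  obtain ⟨Lφ, hφ⟩ := hφLip
  obtain ⟨C, hC⟩ := hbO
  have hdens i := (hident i).trans hfdens
  have hmass : ∫⁻ x, ENNReal.ofReal (f x) ≤ 1 := by
    have := Measure.isProbabilityMeasure_map (μ := P) (hmeas 0).aemeasurable
    rw [hfdens] at this
    have huniv := this.measure_univ
    rw [withDensity_apply _ MeasurableSet.univ, Measure.restrict_univ] at huniv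
    exact huniv.le
  have hF := le_of_lipschitzWith_density hf hmass
  have hsupp : HasCompactSupport φ :=
    .of_support_subset_isCompact isCompact_Icc hφsupp
  have hφi : Integrable φ := hφ.continuous.integrable_of_hasCompactSupport hsupp
  have hφ2 : Integrable fun t => φ t ^ 2 := by
    simp only [sq]
    exact (hφ.continuous.mul hφ.continuous).integrable_of_hasCompactSupport hsupp.mul_right
  obtain ⟨B, hBpos, hB⟩ : ∃ B : ℝ, 0 < B ∧ ∀ t, |φ t| ≤ B := by
    obtain ⟨B, hB⟩ := hsupp.exists_bound_of_continuous hφ.continuous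
    exact ⟨max B 1, by positivity, fun t => (hB t).trans (le_max_left _ _)⟩
  have hCpos : 0 < C := by
    have h := (inv_pos.2 (hbpos 2)).trans_le (hC 2 le_rfl)
    have hlog : 0 < Real.log (2 : ℕ) := Real.log_pos (by norm_num)
    by_contra! hneg
    exact h.not_ge (div_nonpos_of_nonpos_of_nonneg
      (mul_nonpos_of_nonpos_of_nonneg hneg (by positivity)) hlog.le)
  obtain ⟨c, hc⟩ : ∃ c, c = (2 * B * Real.sqrt C)⁻¹ := ⟨_, rfl⟩
  obtain ⟨M₁, hM₁⟩ : ∃ M₁, M₁ = 5 / c + c * ((Lf + 1) * ∫ t, φ t ^ 2) := ⟨_, rfl⟩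
  obtain ⟨M₂, hM₂⟩ : ∃ M₂, M₂ = Lφ * C ^ 2 + Lf * ∫ t, |φ t| := ⟨_, rfl⟩
  refine ⟨M₁ + M₂, ?_⟩
  have hev : ∀ᶠ n : ℕ in atTop, P {ω | (⨆ x : {x : ℝ // |x| ≤ (n : ℝ) ^ ((1 : ℝ) / 3)},
            |((n : ℝ) * b n)⁻¹ * (∑ j ∈ Finset.range n, φ (((x : ℝ) - ε j ω) / b n))
              - ∫ t, f ((x : ℝ) - b n * t) * φ t|)
          > (M₁ + M₂) * (Real.log n / ((n : ℝ) * b n)) ^ ((1 : ℝ) / 2)} ≤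
        ENNReal.ofReal (6 * (n : ℝ)⁻¹) := by
    filter_upwards [hb0.eventually (eventually_le_nhds zero_lt_one), eventually_ge_atTop 3]
      with n hb1 hn
    exact measure_iSup_abs_kernelDeviation_gt_le hmeas hindep hf hf0 hdens hF hφ hφi hφ2 hBpos hB
      hCpos hc hM₁ hM₂ hn (hbpos n) hb1 (hC n (by omega))
  have hlim : Tendsto (fun n : ℕ => ENNReal.ofReal (6 * (n : ℝ)⁻¹)) atTop (nhds 0) := by
    simpa using ENNReal.tendsto_ofReal
      ((tendsto_inv_atTop_nhds_zero_nat (𝕜 := ℝ)).const_mul 6)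
  rw [(tendsto_of_tendsto_of_tendsto_of_le_of_le' tendsto_const_nhds hlim
    (.of_forall fun _ => zero_le) hev).limsup_eq]
  exact ENNReal.ofReal_pos.2 hδ
end
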